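/- arXiv:2502.08433 — 3 statements merged into one kernel-verified Lean document; each statement's English description precedes it below -/
import Mathlib

section
/- Let λ ∈ ℂ with Re λ ≤ 0. If f ∈ E satisfies the homogeneous Stieltjes equation f(x) = λ ∫₀^∞ f(y)/(x+y) dy for all x > 0 (the integral being absolutely convergent), then f(x) = 0 for all x > 0. -/
open MeasureTheory Set Asymptotics

noncomputable section

/-- `r₁(x;α)` from Dixon's resolvent kernels. -/
def r1 (α : ℂ) (x : ℝ) : ℂ :=
  if α = -(1/2 : ℂ) then
    -(2 / (Real.pi : ℂ)) * ((x : ℂ) ^ ((1 : ℂ)/2) * (Real.log x : ℂ)) / (1 - (x : ℂ) ^ 2)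
  else
    (1 / Complex.cos ((Real.pi : ℂ) * α)) *
      (((x : ℂ) ^ (-α) - (x : ℂ) ^ (α + 1)) / (1 - (x : ℂ) ^ 2))

def r2 (α : ℂ) (x : ℝ) : ℂ := -(1 / (x : ℂ)) * r1 (-α) x

def r3 (α : ℂ) (x : ℝ) : ℂ := (x : ℂ) ^ 2 * r2 α x

def R1 (α : ℂ) (x y : ℝ) : ℂ := (1 / (y : ℂ)) * r1 α (x / y)
def R2 (α : ℂ) (x y : ℝ) : ℂ := (1 / (y : ℂ)) * r2 α (x / y)
def R3 (α : ℂ) (x y : ℝ) : ℂ := (1 / (y : ℂ)) * r3 α (x / y)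

/-- membership in `E`: integrable on `(0,∞)` with weight `1/(1+x)`. -/
def MemE (f : ℝ → ℂ) : Prop :=
  IntegrableOn (fun x : ℝ => f x / (1 + (x : ℂ))) (Ioi 0)

/-- membership in `E_k`: integrable on `(0,∞)` with weight `x^{k-1}`. -/
def MemEk (k : ℝ) (f : ℝ → ℂ) : Prop :=
  IntegrableOn (fun x : ℝ => (x ^ (k - 1) : ℝ) • f x) (Ioi 0)

/-- membership in `B_{ε,η}`. -/
def MemB (ε η : ℝ) (f : ℝ → ℂ) : Prop :=
  ContinuousOn f (Ioi 0) ∧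
  ∃ M : ℝ, (∀ x : ℝ, 1 < x → x ^ ε * ‖f x‖ ≤ M) ∧ (∀ x : ℝ, 0 < x → x < 1 → x ^ η * ‖f x‖ ≤ M)

/-- the norm of `B_{ε,η}`. -/
def Bnorm (ε η : ℝ) (f : ℝ → ℂ) : ℝ :=
  sSup ((fun x : ℝ => x ^ ε * ‖f x‖) '' Ioi 1) + sSup ((fun x : ℝ => x ^ η * ‖f x‖) '' Ioo 0 1)

/-- admissible weight pair `(φ₁,φ₂)`. -/
def AdmissiblePair (φ₁ φ₂ : ℝ → ℝ) : Prop :=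
  ContinuousOn φ₁ (Ioi 0) ∧ ContinuousOn φ₂ (Ioi 0) ∧
  (∀ y : ℝ, 0 < y → (φ₁ y ∈ Ioo (0:ℝ) 1 ∧ φ₂ y ∈ Ioo (0:ℝ) 1 ∧ φ₁ y + φ₂ y = 1)) ∧
  φ₁ =O[Filter.atTop] (fun y : ℝ => 1 / y) ∧
  (fun y : ℝ => φ₁ y - 1) =O[nhdsWithin 0 (Ioi 0)] (fun y : ℝ => y)

/-- the combined kernel `R₂₃`. -/
def R23 (φ₁ φ₂ : ℝ → ℝ) (α : ℂ) (x y : ℝ) : ℂ :=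
  (φ₁ y : ℂ) * R2 α x y + (φ₂ y : ℂ) * R3 α x y


/-- An element of `E` is a.e. strongly measurable on `(0, ∞)`. -/
theorem aestronglyMeasurable_of_memE {f : ℝ → ℂ} (hf : MemE f) :
    AEStronglyMeasurable f (volume.restrict (Ioi 0)) := by
  have h := hf.aestronglyMeasurable.mul
    (by fun_prop : Measurable fun x : ℝ => 1 + (x : ℂ)).aestronglyMeasurable
  refine h.congr ?_
  filter_upwards [ae_restrict_mem measurableSet_Ioi] with x hx
  have hx : 0 < x := hx
  have : (1 + (x : ℂ)) ≠ 0 := by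
    have : 1 + x ≠ 0 := by positivity
    exact_mod_cast this
  simp [this]

/-- The Stieltjes transform of `f` is holomorphic on the half-plane `0 < re z + im z`. -/
theorem differentiableOn_stieltjes {f : ℝ → ℂ} (hf : MemE f) :
    DifferentiableOn ℂ (fun z : ℂ => ∫ y in Ioi (0 : ℝ), f y / (z + (y : ℂ)))
      {z : ℂ | 0 < z.re + z.im} := by
  have hfm := aestronglyMeasurable_of_memE hf
  intro z hz
  have hz : 0 < z.re + z.im := hz
  set ρ := z.re + z.im with hρ
  obtain ⟨c, hc0, hc⟩ : ∃ c : ℝ, 0 < c ∧ ∀ x : ℝ, 0 < x → c * (1 + x) ≤ (ρ / 2 + x) / 2 := by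
    refine ⟨min (ρ / 4) (1 / 2), by positivity, fun x hx => ?_⟩
    have h1 := min_le_left (ρ / 4) (1 / 2 : ℝ)
    have h2 := mul_le_mul_of_nonneg_right (min_le_right (ρ / 4) (1 / 2 : ℝ)) hx.le
    linarith
  have hlow : ∀ u ∈ Metric.ball z (ρ / 4), ∀ x : ℝ, 0 < x → c * (1 + x) ≤ ‖u + (x : ℂ)‖ := by
    intro u hu x hx
    rw [mem_ball_iff_norm] at hu
    have h1 := (Complex.abs_re_le_norm (u - z)).trans hu.le
    have h2 := (Complex.abs_im_le_norm (u - z)).trans hu.le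
    have h3 := Complex.abs_re_le_norm (u + (x : ℂ))
    have h4 := Complex.abs_im_le_norm (u + (x : ℂ))
    rw [abs_le] at h1 h2 h3 h4
    simp only [Complex.sub_re, Complex.sub_im, Complex.add_re, Complex.add_im,
      Complex.ofReal_re, Complex.ofReal_im] at h1 h2 h3 h4
    have := hc x hx
    linarith
  have hmeas : ∀ u : ℂ, AEStronglyMeasurable (fun y : ℝ => f y / (u + (y : ℂ)))
      (volume.restrict (Ioi 0)) := fun u => by
    simp only [div_eq_mul_inv]
    exact hfm.mul (by fun_prop : Measurable fun y : ℝ => (u + (y : ℂ))⁻¹).aestronglyMeasurable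
  have hnorm : ∀ x : ℝ, 0 < x → ‖f x / (1 + (x : ℂ))‖ = ‖f x‖ / (1 + x) := fun x hx => by
    rw [norm_div, ← Complex.ofReal_one, ← Complex.ofReal_add, Complex.norm_of_nonneg (by linarith)]
  have hint := hf.norm
  refine DifferentiableAt.differentiableWithinAt ?_
  refine (hasDerivAt_integral_of_dominated_loc_of_deriv_le
    (F' := fun u y => -f y / (u + (y : ℂ)) ^ 2)
    (bound := fun x => (1 / c ^ 2) * ‖f x / (1 + (x : ℂ))‖)
    (Metric.ball_mem_nhds z (by positivity : 0 < ρ / 4)) (Filter.Eventually.of_forall hmeas)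
    ?_ ?_ ?_ ?_ ?_).2.differentiableAt
  · refine (hint.const_mul (1 / c)).mono' (hmeas z) ?_
    filter_upwards [ae_restrict_mem measurableSet_Ioi] with x hx
    have hx : 0 < x := hx
    have h1 := hlow z (Metric.mem_ball_self (by positivity)) x hx
    rw [hnorm x hx, norm_div, div_mul_div_comm, one_mul]
    gcongr
  · simp only [div_eq_mul_inv]
    exact hfm.neg.mul
      (by fun_prop : Measurable fun y : ℝ => ((z + (y : ℂ)) ^ 2)⁻¹).aestronglyMeasurable
  · filter_upwards [ae_restrict_mem measurableSet_Ioi] with x hx u hu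
    have hx : 0 < x := hx
    have h1 := hlow u hu x hx
    rw [hnorm x hx, norm_div, div_mul_div_comm, one_mul, norm_neg, norm_pow]
    have h2 : c ^ 2 * (1 + x) ≤ ‖u + (x : ℂ)‖ ^ 2 :=
      calc c ^ 2 * (1 + x) ≤ (c * (1 + x)) ^ 2 := by
            have := mul_nonneg (sq_nonneg c) hx.le
            nlinarith [mul_nonneg this hx.le]
        _ ≤ _ := by gcongr
    gcongr
  · exact hint.const_mul _
  · filter_upwards [ae_restrict_mem measurableSet_Ioi] with x hx u hu
    have hx : 0 < x := hx
    have h0 : u + (x : ℂ) ≠ 0 := norm_pos_iff.1 ((by positivity : 0 < c * (1 + x)).trans_le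
      (hlow u hu x hx))
    have := (((hasDerivAt_id u).add_const (x : ℂ)).fun_inv h0).const_mul (f x)
    simp only [id, ← div_eq_mul_inv] at this
    exact this.congr_deriv (by ring)

/-- The Stieltjes transform of a solution vanishes at `a * I` for `1 ≤ a`: pairing the equation
with the weight `x / (a ^ 2 + x ^ 2)` symmetrises the Stieltjes kernel into the nonnegative
finite-rank kernel `(a ^ 2 + x * y) / ((a ^ 2 + x ^ 2) * (a ^ 2 + y ^ 2))`. -/
theorem stieltjes_mul_I_eq_zero {lam : ℂ} (hlam : lam.re ≤ 0) (hlam0 : lam ≠ 0) {f : ℝ → ℂ}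
    (hf : MemE f)
    (heq : ∀ x : ℝ, 0 < x → f x = lam * ∫ y in Ioi (0 : ℝ), f y / ((x : ℂ) + (y : ℂ)))
    {a : ℝ} (ha : 1 ≤ a) :
    ∫ y in Ioi (0 : ℝ), f y / ((a : ℂ) * Complex.I + (y : ℂ)) = 0 := by
  have hfm := aestronglyMeasurable_of_memE hf
  set μ : Measure ℝ := volume.restrict (Ioi 0) with hμ
  have ha0 : 0 < a := by linarith
  have hpos : ∀ᵐ x ∂μ, 0 < x := ae_restrict_mem measurableSet_Ioi
  have hposp : ∀ᵐ p ∂(μ.prod μ), 0 < p.1 ∧ 0 < p.2 :=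
    (Measure.quasiMeasurePreserving_fst.ae hpos).and (Measure.quasiMeasurePreserving_snd.ae hpos)
  have hnorm : ∀ x : ℝ, 0 < x → ‖f x / (1 + (x : ℂ))‖ = ‖f x‖ / (1 + x) := fun x hx => by
    rw [norm_div, ← Complex.ofReal_one, ← Complex.ofReal_add, Complex.norm_of_nonneg (by linarith)]
  have hint : Integrable (fun x : ℝ => ‖f x / (1 + (x : ℂ))‖) μ := hf.norm
  have hweight : ∀ w : ℝ → ℝ, Measurable w → (∀ x, 0 < x → |w x| ≤ 2 / (1 + x)) →
      Integrable (fun x : ℝ => (w x : ℂ) * f x) μ := by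
    intro w hw hb
    refine (hint.const_mul 2).mono'
      ((Complex.measurable_ofReal.comp hw).aestronglyMeasurable.mul hfm) ?_
    filter_upwards [hpos] with x hx
    rw [hnorm x hx, norm_mul, Complex.norm_real, Real.norm_eq_abs]
    calc |w x| * ‖f x‖ ≤ 2 / (1 + x) * ‖f x‖ := by gcongr; exact hb x hx
      _ = _ := by ring
  have hA : Integrable (fun x : ℝ => ((1 / (a ^ 2 + x ^ 2) : ℝ) : ℂ) * f x) μ := by
    refine hweight _ (by fun_prop) fun x hx => ?_
    rw [abs_of_pos (by positivity), div_le_div_iff₀ (by positivity) (by positivity)]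
    nlinarith [sq_nonneg (x - 1)]
  have hB : Integrable (fun x : ℝ => ((x / (a ^ 2 + x ^ 2) : ℝ) : ℂ) * f x) μ := by
    refine hweight _ (by fun_prop) fun x hx => ?_
    rw [abs_of_pos (by positivity), div_le_div_iff₀ (by positivity) (by positivity)]
    nlinarith [sq_nonneg (x - 1)]
  set A := ∫ x, ((1 / (a ^ 2 + x ^ 2) : ℝ) : ℂ) * f x ∂μ with hAdef
  set B := ∫ x, ((x / (a ^ 2 + x ^ 2) : ℝ) : ℂ) * f x ∂μ with hBdef
  let k : ℝ × ℝ → ℂ := fun p =>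
    ((p.1 / (a ^ 2 + p.1 ^ 2) / (p.1 + p.2) : ℝ) : ℂ) * (starRingEnd ℂ (f p.1) * f p.2)
  have hk : Integrable k (μ.prod μ) := by
    refine ((hint.mul_prod hint).const_mul 2).mono' ?_ ?_
    · refine Measurable.aestronglyMeasurable (by fun_prop) |>.mul ?_
      exact (Complex.continuous_conj.comp_aestronglyMeasurable hfm.comp_fst).mul hfm.comp_snd
    · filter_upwards [hposp] with p hp
      obtain ⟨hx, hy⟩ := hp
      obtain ⟨x, y⟩ := p
      simp only at hx hy
      simp only [k]
      rw [hnorm x hx, hnorm y hy, norm_mul, norm_mul, Complex.norm_real, Real.norm_eq_abs,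
        RCLike.norm_conj, abs_of_pos (by positivity)]
      have : x / (a ^ 2 + x ^ 2) / (x + y) ≤ 2 / ((1 + x) * (1 + y)) := by
        rw [div_div, div_le_div_iff₀ (by positivity) (by positivity)]
        have h1 : (1 + x ^ 2) * (x + y) ≤ (a ^ 2 + x ^ 2) * (x + y) := by
          gcongr; nlinarith
        nlinarith [mul_nonneg hy.le (sq_nonneg (x - 1)), mul_nonneg hx.le (sq_nonneg (x - 1)),
          mul_pos hx hy, mul_pos (mul_pos hx hx) hx]
      calc _ ≤ 2 / ((1 + x) * (1 + y)) * (‖f x‖ * ‖f y‖) := by gcongr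
        _ = _ := by field_simp
  set Q := ∫ p, k p ∂(μ.prod μ) with hQ
  have hQre : Q + starRingEnd ℂ Q =
      (a : ℂ) ^ 2 * (starRingEnd ℂ A * A) + starRingEnd ℂ B * B := by
    have hks : Integrable (fun p => starRingEnd ℂ (k p.swap)) (μ.prod μ) :=
      Complex.conjCLE.toContinuousLinearMap.integrable_comp hk.swap
    have hAA : Integrable (fun p : ℝ × ℝ =>
        starRingEnd ℂ (((1 / (a ^ 2 + p.1 ^ 2) : ℝ) : ℂ) * f p.1) *
          (((1 / (a ^ 2 + p.2 ^ 2) : ℝ) : ℂ) * f p.2)) (μ.prod μ) :=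
      (Complex.conjCLE.toContinuousLinearMap.integrable_comp hA).mul_prod hA
    have hBB : Integrable (fun p : ℝ × ℝ =>
        starRingEnd ℂ (((p.1 / (a ^ 2 + p.1 ^ 2) : ℝ) : ℂ) * f p.1) *
          (((p.2 / (a ^ 2 + p.2 ^ 2) : ℝ) : ℂ) * f p.2)) (μ.prod μ) :=
      (Complex.conjCLE.toContinuousLinearMap.integrable_comp hB).mul_prod hB
    have h1 : starRingEnd ℂ Q = ∫ p, starRingEnd ℂ (k p.swap) ∂(μ.prod μ) := by
      rw [integral_conj, integral_prod_swap]
    rw [h1, hQ, ← integral_add hk hks, hAdef, hBdef, ← integral_conj, ← integral_conj,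
      ← integral_prod_mul, ← integral_prod_mul, ← integral_const_mul,
      ← integral_add (hAA.const_mul _) hBB]
    refine integral_congr_ae ?_
    filter_upwards [hposp] with p hp
    obtain ⟨hx, hy⟩ := hp
    obtain ⟨x, y⟩ := p
    simp only at hx hy
    simp only [k, Prod.swap, map_mul, Complex.conj_ofReal, Complex.conj_conj]
    have key : x / (a ^ 2 + x ^ 2) / (x + y) + y / (a ^ 2 + y ^ 2) / (y + x) =
        a ^ 2 * (1 / (a ^ 2 + x ^ 2) * (1 / (a ^ 2 + y ^ 2))) +
          x / (a ^ 2 + x ^ 2) * (y / (a ^ 2 + y ^ 2)) := by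
      rw [add_comm y x]
      field_simp
      ring
    have key' := congrArg (fun r : ℝ => (r : ℂ) * (starRingEnd ℂ (f x) * f y)) key
    simp only [Complex.ofReal_add, Complex.ofReal_mul, Complex.ofReal_pow] at key' ⊢
    linear_combination key'
  have hN : ((∫ x, x / (a ^ 2 + x ^ 2) * ‖f x‖ ^ 2 ∂μ : ℝ) : ℂ) = lam * Q := by
    rw [hQ, integral_prod _ hk, ← integral_const_mul, ← integral_complex_ofReal]
    refine integral_congr_ae ?_
    filter_upwards [hpos] with x hx
    have h1 : ∫ y, k (x, y) ∂μ = (((x / (a ^ 2 + x ^ 2) : ℝ) : ℂ) * starRingEnd ℂ (f x)) *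
        ∫ y, f y / ((x : ℂ) + (y : ℂ)) ∂μ := by
      rw [← integral_const_mul]
      congr 1 with y
      simp only [k, Complex.ofReal_div, Complex.ofReal_add]
      ring
    rw [h1]
    have h2 := heq x hx
    have h3 := Complex.conj_mul' (f x)
    rw [Complex.ofReal_mul, Complex.ofReal_pow, ← h3]
    linear_combination ((x / (a ^ 2 + x ^ 2) : ℝ) : ℂ) * starRingEnd ℂ (f x) * h2
  have hN0 : 0 ≤ ∫ x, x / (a ^ 2 + x ^ 2) * ‖f x‖ ^ 2 ∂μ := by
    refine integral_nonneg_of_ae ?_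
    filter_upwards [hpos] with x hx
    simp only [Pi.zero_apply]
    positivity
  set N := ∫ x, x / (a ^ 2 + x ^ 2) * ‖f x‖ ^ 2 ∂μ
  have hQle : Q.re ≤ 0 := by
    have h1 : Q = (N : ℂ) / lam := by rw [hN]; field_simp
    rw [h1, Complex.div_re]
    simp only [Complex.ofReal_re, Complex.ofReal_im, zero_mul, zero_div, add_zero]
    exact div_nonpos_of_nonpos_of_nonneg (mul_nonpos_of_nonneg_of_nonpos hN0 hlam)
      (Complex.normSq_nonneg _)
  have hsum : 2 * Q.re = a ^ 2 * ‖A‖ ^ 2 + ‖B‖ ^ 2 := by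
    rw [Complex.add_conj, Complex.conj_mul', Complex.conj_mul'] at hQre
    exact_mod_cast hQre
  have hA2 : 0 ≤ a ^ 2 * ‖A‖ ^ 2 := by positivity
  have hB2 : 0 ≤ ‖B‖ ^ 2 := by positivity
  have hB0 : B = 0 := by
    have : ‖B‖ ^ 2 = 0 := by linarith
    simpa using this
  have hA0 : A = 0 := by
    have : a ^ 2 * ‖A‖ ^ 2 = 0 := by linarith
    simpa [ha0.ne'] using this
  have hfin : ∫ y, f y / ((a : ℂ) * Complex.I + (y : ℂ)) ∂μ = B - (a : ℂ) * Complex.I * A := by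
    rw [hAdef, hBdef, ← integral_const_mul, ← integral_sub hB (hA.const_mul _)]
    refine integral_congr_ae ?_
    filter_upwards [hpos] with x hx
    have h0 : (a : ℂ) * Complex.I + (x : ℂ) ≠ 0 := fun h => by
      have := congrArg Complex.re h
      simp at this
      linarith
    have h1 : (a : ℂ) ^ 2 + (x : ℂ) ^ 2 ≠ 0 := by
      have : a ^ 2 + x ^ 2 ≠ 0 := by positivity
      exact_mod_cast this
    push_cast
    field_simp
    linear_combination (a : ℂ) ^ 2 * f x * Complex.I_sq
  rw [hfin, hA0, hB0, mul_zero, sub_zero]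

/-- if `Re λ ≤ 0` and `f ∈ E` solves the homogeneous Stieltjes equation,
then `f` vanishes on `(0,∞)`. -/
theorem stmt0 (lam : ℂ) (hlam : lam.re ≤ 0) (f : ℝ → ℂ) (hf : MemE f)
    (heq : ∀ x : ℝ, 0 < x →
      IntegrableOn (fun y : ℝ => f y / ((x : ℂ) + (y : ℂ))) (Ioi 0) ∧
      f x = lam * ∫ y in Ioi (0 : ℝ), f y / ((x : ℂ) + (y : ℂ))) :
    ∀ x : ℝ, 0 < x → f x = 0 := by
  intro x hx
  rcases eq_or_ne lam 0 with rfl | hlam0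
  · rw [(heq x hx).2, zero_mul]
  have hopen : IsOpen {z : ℂ | 0 < z.re + z.im} :=
    isOpen_lt continuous_const (Complex.continuous_re.add Complex.continuous_im)
  have hconv : Convex ℝ {z : ℂ | 0 < z.re + z.im} :=
    convex_halfSpace_gt (Complex.reLm + Complex.imLm).isLinear 0
  have hfreq : ∃ᶠ z in nhdsWithin (2 * Complex.I) {2 * Complex.I}ᶜ,
      ∫ y in Ioi (0 : ℝ), f y / (z + (y : ℂ)) = 0 := by
    have ht : Filter.Tendsto (fun a : ℝ => (a : ℂ) * Complex.I) (nhdsWithin 2 {2}ᶜ)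
        (nhdsWithin (2 * Complex.I) {2 * Complex.I}ᶜ) := by
      refine tendsto_nhdsWithin_iff.2 ⟨?_, ?_⟩
      · have : Continuous fun a : ℝ => (a : ℂ) * Complex.I := by fun_prop
        exact (this.tendsto' 2 _ (by norm_num)).mono_left nhdsWithin_le_nhds
      · filter_upwards [self_mem_nhdsWithin] with a ha h
        refine ha ?_
        have := congrArg Complex.im h
        simpa using this
    refine ht.frequently (Filter.Eventually.frequently ?_)
    filter_upwards [nhdsWithin_le_nhds (Ici_mem_nhds (by norm_num : (1 : ℝ) < 2))] with a ha
    exact stieltjes_mul_I_eq_zero hlam hlam0 hf (fun x hx => (heq x hx).2) ha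
  have hzero := ((differentiableOn_stieltjes hf).analyticOnNhd
    hopen).eqOn_zero_of_preconnected_of_frequently_eq_zero hconv.isPreconnected
    (by simp : 2 * Complex.I ∈ {z : ℂ | 0 < z.re + z.im}) hfreq
  have hx0 := hzero (by simpa using hx : (x : ℂ) ∈ {z : ℂ | 0 < z.re + z.im})
  rw [(heq x hx).2]
  simp only [Pi.zero_apply] at hx0
  rw [hx0, mul_zero]

end
end

section
/- Let α ∈ ℂ with 0 < Re α ≤ 1/2 and α ≠ 1/2, and set λ = sin(πα)/π (so Re λ > 0 and λ ≠ 1/π). Then f ∈ E satisfies the homogeneous Stieltjes equation f(x) = λ ∫₀^∞ f(y)/(x+y) dy for all x > 0 if and only if there exist constants A, B ∈ ℂ such that f(x) = A·x^{-α} + B·x^{α-1} for all x > 0. -/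
open MeasureTheory Set Asymptotics

noncomputable section

/-- A holomorphic function on the punctured plane whose growth at `0` and at `∞` is strictly slower
than `1/‖ζ‖` and `‖ζ‖` is constant. -/
theorem eq_const_of_norm_le_rpow {Q : ℂ → ℂ} {C a : ℝ} (ha0 : 0 ≤ a) (ha : a < 1)
    (hd : DifferentiableOn ℂ Q {0}ᶜ)
    (hb : ∀ ζ : ℂ, ζ ≠ 0 → ‖Q ζ‖ ≤ C * (‖ζ‖ ^ a + ‖ζ‖ ^ (-a))) :
    ∃ c, ∀ ζ, ζ ≠ 0 → Q ζ = c := by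
  have hC : 0 ≤ C := by
    have := (norm_nonneg _).trans (hb 1 one_ne_zero)
    norm_num at this; linarith
  have hlo : (fun z => Q z - Q 0) =o[nhdsWithin 0 {0}ᶜ] fun z => (z - 0)⁻¹ := by
    have h1 : Filter.Tendsto (fun z : ℂ => ‖z‖ ^ (1 + a) + ‖z‖ ^ (1 - a)) (nhdsWithin 0 {0}ᶜ)
        (nhds 0) := by
      have : ContinuousAt (fun z : ℂ => ‖z‖ ^ (1 + a) + ‖z‖ ^ (1 - a)) 0 := by
        apply ContinuousAt.add
        · exact continuous_norm.continuousAt.rpow_const (Or.inr (by linarith))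
        · exact continuous_norm.continuousAt.rpow_const (Or.inr (by linarith))
      have h2 := this.tendsto
      simp only [norm_zero] at h2
      rw [Real.zero_rpow (by linarith), Real.zero_rpow (by linarith), add_zero] at h2
      exact h2.mono_left nhdsWithin_le_nhds
    have h2 : Filter.Tendsto (fun z : ℂ => z * (Q z - Q 0)) (nhdsWithin 0 {0}ᶜ) (nhds 0) := by
      have h3 : Filter.Tendsto (fun z : ℂ => C * (‖z‖ ^ (1 + a) + ‖z‖ ^ (1 - a)) + ‖z‖ * ‖Q 0‖)
          (nhdsWithin 0 {0}ᶜ) (nhds 0) := by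
        have h4 : Filter.Tendsto (fun z : ℂ => ‖z‖ * ‖Q 0‖) (nhdsWithin 0 {0}ᶜ) (nhds 0) := by
          have : Continuous fun z : ℂ => ‖z‖ * ‖Q 0‖ := by fun_prop
          have := this.tendsto 0
          simp only [norm_zero, zero_mul] at this
          exact this.mono_left nhdsWithin_le_nhds
        simpa using (h1.const_mul C).add h4
      refine squeeze_zero_norm' ?_ h3
      filter_upwards [self_mem_nhdsWithin] with z hz
      have hz0 : 0 < ‖z‖ := norm_pos_iff.2 hz
      rw [norm_mul, Real.rpow_add hz0, sub_eq_add_neg 1 a, Real.rpow_add hz0, Real.rpow_one]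
      have := hb z hz
      have h5 := norm_sub_le (Q z) (Q 0)
      nlinarith
    rw [isLittleO_iff_tendsto']
    · refine h2.congr fun z => ?_
      simp [div_eq_mul_inv, mul_comm]
    · filter_upwards [self_mem_nhdsWithin] with z hz h
      simp at h; exact absurd h hz
  have hS := Complex.differentiableOn_update_limUnder_of_isLittleO (s := Set.univ) (f := Q) (c := 0)
    Filter.univ_mem (by simpa [Set.compl_eq_univ_sdiff] using hd) hlo
  set S := Function.update Q 0 (Filter.limUnder (nhdsWithin 0 {0}ᶜ) Q) with hSdef
  have hSd : Differentiable ℂ S := differentiableOn_univ.1 hS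
  have hSQ : ∀ z, z ≠ 0 → S z = Q z := fun z hz => by simp [hSdef, hz]
  have hder : ∀ c, deriv S c = 0 := by
    intro c
    have hlim : Filter.Tendsto (fun R : ℝ => C * (2 * R) ^ a / R + C / R) Filter.atTop (nhds 0) := by
      have e1 : Filter.Tendsto (fun R : ℝ => (C * 2 ^ a) * R ^ (-(1 - a))) Filter.atTop (nhds 0) := by
        simpa using (tendsto_rpow_neg_atTop (y := 1 - a) (by linarith)).const_mul (C * 2 ^ a)
      have e2 : Filter.Tendsto (fun R : ℝ => C / R) Filter.atTop (nhds 0) :=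
        tendsto_const_nhds.div_atTop Filter.tendsto_id
      have := e1.add e2
      rw [add_zero] at this
      refine this.congr' ?_
      filter_upwards [Filter.eventually_gt_atTop 0] with R hR
      rw [Real.mul_rpow (by norm_num) hR.le, neg_sub, Real.rpow_sub hR, Real.rpow_one]
      ring
    have hle : ∀ᶠ R : ℝ in Filter.atTop, ‖deriv S c‖ ≤ C * (2 * R) ^ a / R + C / R := by
      filter_upwards [Filter.eventually_gt_atTop (‖c‖ + 1)] with R hR
      have hRpos : 0 < R := by linarith [norm_nonneg c]
      have := Complex.norm_deriv_le_of_forall_mem_sphere_norm_le (c := c) (R := R)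
        (C := C * (2 * R) ^ a + C) (f := S) hRpos hSd.diffContOnCl ?_
      · rwa [add_div] at this
      · intro z hz
        have hz' : ‖z - c‖ = R := by simpa [dist_eq_norm] using hz
        have h1 : 1 ≤ ‖z‖ := by
          have := norm_sub_le z c
          linarith
        have h2 : ‖z‖ ≤ 2 * R := by
          have := norm_add_le (z - c) c
          rw [sub_add_cancel] at this
          linarith
        have hz0 : z ≠ 0 := by rw [← norm_pos_iff]; linarith
        rw [hSQ z hz0]
        refine (hb z hz0).trans ?_
        have h3 : ‖z‖ ^ a ≤ (2 * R) ^ a := Real.rpow_le_rpow (by linarith) h2 ha0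
        have h4 : ‖z‖ ^ (-a) ≤ 1 := Real.rpow_le_one_of_one_le_of_nonpos h1 (by linarith)
        nlinarith
    have := ge_of_tendsto hlim hle
    exact norm_le_zero_iff.1 this
  refine ⟨S 1, fun ζ hζ => ?_⟩
  rw [← hSQ ζ hζ]
  exact is_const_of_deriv_eq_zero hSd hder ζ 1

/-- A holomorphic function on the strip `|Im w| < π` which has period `iπ` and grows slower than
`exp (2 |Re w|)` is constant. -/
theorem periodic_strip_const {M : ℂ → ℂ} {C a : ℝ} (ha0 : 0 ≤ a) (ha : a < 2)
    (hd : ∀ w : ℂ, |w.im| < Real.pi → DifferentiableAt ℂ M w)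
    (hper : ∀ w : ℂ, |w.im| < Real.pi / 2 →
      M (w + Real.pi / 2 * Complex.I) = M (w - Real.pi / 2 * Complex.I))
    (hb : ∀ w : ℂ, |w.im| ≤ Real.pi / 2 → ‖M w‖ ≤ C * Real.exp (a * |w.re|)) :
    ∃ c, ∀ u : ℝ, M (u + Real.pi / 2 * Complex.I) = c := by
  have hpi := Real.pi_pos
  have hC : 0 ≤ C := by
    have := (norm_nonneg _).trans (hb 0 (by simp; positivity))
    simpa using this
  have him : ∀ ζ : ℂ, (1 / 2 * Complex.log ζ).im = ζ.arg / 2 := by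
    intro ζ; simp [Complex.mul_im, Complex.log_im]; ring
  have hre : ∀ ζ : ℂ, (1 / 2 * Complex.log ζ).re = Real.log ‖ζ‖ / 2 := by
    intro ζ; simp [Complex.mul_re, Complex.log_re]; ring
  have harg : ∀ ζ : ℂ, |(1 / 2 * Complex.log ζ).im| ≤ Real.pi / 2 := by
    intro ζ
    rw [him, abs_div, abs_two]
    have := Complex.abs_arg_le_pi ζ
    linarith
  have hcompat : ∀ ζ : ℂ, ζ.re < 0 → M (1 / 2 * Complex.log ζ) =
      M (1 / 2 * Complex.log (-ζ) + Real.pi / 2 * Complex.I) := by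
    intro ζ hζ
    have hζ0 : ζ ≠ 0 := by rintro rfl; simp at hζ
    have hlog : Complex.log ζ = Complex.log (-ζ) + Real.pi * Complex.I ∨
        Complex.log ζ = Complex.log (-ζ) - Real.pi * Complex.I := by
      rcases le_or_gt 0 ζ.im with h | h
      · left
        apply Complex.ext
        · simp [Complex.log_re]
        · simp only [Complex.log_im, Complex.add_im]
          rw [Complex.arg_of_re_neg_of_im_nonneg hζ h, Complex.arg_of_re_nonneg
            (x := -ζ) (by simp; linarith)]
          simp
      · right
        apply Complex.ext
        · simp [Complex.log_re]
        · simp only [Complex.log_im, Complex.sub_im]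
          rw [Complex.arg_of_re_neg_of_im_neg hζ h, Complex.arg_of_re_nonneg
            (x := -ζ) (by simp; linarith)]
          simp
    have him2 : |(1 / 2 * Complex.log (-ζ)).im| < Real.pi / 2 := by
      rw [him, abs_div, abs_two]
      have : |(-ζ).arg| < Real.pi / 2 := Complex.abs_arg_lt_pi_div_two_iff.2 (Or.inl (by simpa))
      linarith
    rcases hlog with h | h
    · rw [h]; congr 1; ring
    · rw [hper _ him2, h]; congr 1; ring
  have hconst : (∃ c, ∀ ζ, ζ ≠ 0 → M (1 / 2 * Complex.log ζ) = c) := by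
    refine eq_const_of_norm_le_rpow (Q := fun ζ => M (1 / 2 * Complex.log ζ)) (C := C)
      (a := a / 2) (by linarith) (by linarith) ?_ ?_
    · intro ζ hζ
      apply DifferentiableAt.differentiableWithinAt
      rcases lt_or_ge ζ.re 0 with h | h
      · have hev : (fun ζ => M (1 / 2 * Complex.log ζ)) =ᶠ[nhds ζ]
            fun ζ => M (1 / 2 * Complex.log (-ζ) + Real.pi / 2 * Complex.I) := by
          filter_upwards [(isOpen_Iio.preimage Complex.continuous_re).mem_nhds h] with z hz
          exact hcompat z hz
        rw [hev.differentiableAt_iff]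
        refine DifferentiableAt.comp (g := M)
          (f := fun ζ => 1 / 2 * Complex.log (-ζ) + Real.pi / 2 * Complex.I) ζ ?_ ?_
        · apply hd
          have : |(-ζ).arg| < Real.pi / 2 := Complex.abs_arg_lt_pi_div_two_iff.2 (Or.inl (by simpa))
          rw [Complex.add_im, him]
          have e : ((Real.pi : ℂ) / 2 * Complex.I).im = Real.pi / 2 := by simp
          rw [e]
          rw [abs_lt] at this ⊢
          constructor <;> linarith
        · have : -ζ ∈ Complex.slitPlane := Or.inl (by simpa)
          fun_prop (disch := assumption)
      · have hs : ζ ∈ Complex.slitPlane := by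
          rw [Complex.mem_slitPlane_iff]
          rcases h.lt_or_eq with h | h
          · exact Or.inl h
          · right; intro h'; exact hζ (Complex.ext h.symm h')
        refine DifferentiableAt.comp (g := M) (f := fun ζ => 1 / 2 * Complex.log ζ) ζ ?_ ?_
        · apply hd
          exact (harg ζ).trans_lt (by linarith)
        · fun_prop (disch := assumption)
    · intro ζ hζ
      refine (hb _ (harg ζ)).trans ?_
      refine mul_le_mul_of_nonneg_left ?_ hC
      have hp : 0 < ‖ζ‖ := norm_pos_iff.2 hζ
      rw [hre, Real.rpow_def_of_pos hp, Real.rpow_def_of_pos hp, abs_div, abs_two]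
      rcases abs_cases (Real.log ‖ζ‖) with ⟨h, -⟩ | ⟨h, -⟩
      · rw [h]
        have : a * (Real.log ‖ζ‖ / 2) = Real.log ‖ζ‖ * (a / 2) := by ring
        rw [this]
        linarith [Real.exp_pos (Real.log ‖ζ‖ * -(a / 2))]
      · rw [h]
        have : a * (-Real.log ‖ζ‖ / 2) = Real.log ‖ζ‖ * -(a / 2) := by ring
        rw [this]
        linarith [Real.exp_pos (Real.log ‖ζ‖ * (a / 2))]
  obtain ⟨c, hc⟩ := hconst
  refine ⟨c, fun u => ?_⟩
  have hre0 : (-Complex.exp (2 * u : ℝ)).re < 0 := by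
    rw [← Complex.ofReal_exp, Complex.neg_re, Complex.ofReal_re]
    linarith [Real.exp_pos (2 * u)]
  have h1 := hc (-Complex.exp (2 * u : ℝ)) (by simp [Complex.exp_ne_zero])
  rw [hcompat _ hre0, neg_neg, ← Complex.ofReal_exp, ← Complex.ofReal_log (Real.exp_pos _).le,
    Real.log_exp] at h1
  rw [← h1]
  congr 1
  push_cast
  ring_nf

/-- The Stieltjes kernel in logarithmic coordinates. -/
def sechKer (t : ℝ) : ℝ := 1 / (2 * Real.cosh (t / 2))

/-- A second order difference of `sechKer`, annihilating `exp (± t / 2)`. -/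
def diffKer (t : ℝ) : ℝ := sechKer (t + 2) + sechKer (t - 2) - 2 * Real.cosh 1 * sechKer t

/-- The holomorphic function `w / (2 sinh (w / 2))`, the self-convolution of `sechKer`. -/
def cschKer (w : ℂ) : ℂ := (dslope Complex.sinh 0 (w / 2))⁻¹

/-- The second order difference of `cschKer`, the convolution of `sechKer` and `diffKer`. -/
def diffCschKer (w : ℂ) : ℂ :=
  cschKer (w + 2) + cschKer (w - 2) - 2 * Real.cosh 1 * cschKer w

theorem sechKer_pos (t : ℝ) : 0 < sechKer t := by
  unfold sechKer; have := Real.cosh_pos (t / 2); positivity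

theorem exp_abs_le_two_mul_cosh (x : ℝ) : Real.exp |x| ≤ 2 * Real.cosh x := by
  rw [Real.cosh_eq]
  rcases abs_cases x with ⟨h, -⟩ | ⟨h, -⟩ <;> rw [h] <;>
    linarith [Real.exp_pos x, Real.exp_pos (-x)]

theorem sechKer_le (t : ℝ) : sechKer t ≤ Real.exp (-|t| / 2) := by
  unfold sechKer
  have h := exp_abs_le_two_mul_cosh (t / 2)
  rw [abs_div, abs_two] at h
  rw [neg_div, Real.exp_neg, one_div]
  exact inv_anti₀ (Real.exp_pos _) h

theorem continuous_sechKer : Continuous sechKer := by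
  unfold sechKer
  have : ∀ t : ℝ, 2 * Real.cosh (t / 2) ≠ 0 := fun t => by
    have := Real.cosh_pos (t / 2); positivity
  fun_prop (disch := exact this _)

theorem continuous_diffKer : Continuous diffKer := by
  unfold diffKer
  have := continuous_sechKer
  fun_prop

theorem diffKer_eq (t : ℝ) : diffKer t =
    -(8 * Real.cosh 1 * Real.sinh 1 ^ 2) * (sechKer t * sechKer (t + 2) * sechKer (t - 2)) := by
  unfold diffKer sechKer
  have e1 : (t + 2) / 2 = t / 2 + 1 := by ring
  have e2 : (t - 2) / 2 = t / 2 - 1 := by ring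
  rw [e1, e2]
  have h1 := Real.cosh_pos (t / 2)
  have h2 := Real.cosh_pos (t / 2 + 1)
  have h3 := Real.cosh_pos (t / 2 - 1)
  have h4 : Real.cosh (t / 2 + 1) + Real.cosh (t / 2 - 1) =
      2 * Real.cosh (t / 2) * Real.cosh 1 := by
    rw [Real.cosh_add, Real.cosh_sub]; ring
  have h5 : Real.cosh (t / 2 + 1) * Real.cosh (t / 2 - 1) =
      Real.cosh (t / 2) ^ 2 + Real.sinh 1 ^ 2 := by
    rw [Real.cosh_add, Real.cosh_sub]
    linear_combination Real.cosh (t / 2) ^ 2 * Real.cosh_sq 1 - Real.sinh 1 ^ 2 * Real.sinh_sq (t / 2)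
  generalize Real.cosh (t / 2) = x at *
  generalize Real.cosh (t / 2 + 1) = y at *
  generalize Real.cosh (t / 2 - 1) = z at *
  field_simp
  linear_combination 4 * x * h4 - 8 * Real.cosh 1 * h5

theorem exists_abs_diffKer_le : ∃ C, 0 ≤ C ∧ ∀ t, |diffKer t| ≤ C * Real.exp (-(3 / 2) * |t|) := by
  refine ⟨8 * Real.cosh 1 * Real.sinh 1 ^ 2 * (Real.exp 1 * Real.exp 1), ?_, fun t => ?_⟩
  · have := Real.cosh_pos 1; positivity
  have hc : 0 ≤ 8 * Real.cosh 1 * Real.sinh 1 ^ 2 := by have := Real.cosh_pos 1; positivity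
  have p0 := sechKer_pos t
  have p1 := sechKer_pos (t + 2)
  have p2 := sechKer_pos (t - 2)
  have h1 : sechKer (t + 2) ≤ Real.exp 1 * Real.exp (-|t| / 2) := by
    refine (sechKer_le _).trans ?_
    rw [← Real.exp_add, Real.exp_le_exp]
    have := abs_sub_abs_le_abs_sub t (-2)
    norm_num at this
    linarith
  have h2 : sechKer (t - 2) ≤ Real.exp 1 * Real.exp (-|t| / 2) := by
    refine (sechKer_le _).trans ?_
    rw [← Real.exp_add, Real.exp_le_exp]
    have := abs_sub_abs_le_abs_sub t 2
    norm_num at this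
    linarith
  rw [diffKer_eq, abs_mul, abs_neg, abs_of_nonneg hc, abs_of_pos (by positivity),
    mul_assoc (8 * Real.cosh 1 * Real.sinh 1 ^ 2) (Real.exp 1 * Real.exp 1)]
  refine mul_le_mul_of_nonneg_left ?_ hc
  calc sechKer t * sechKer (t + 2) * sechKer (t - 2)
      ≤ Real.exp (-|t| / 2) * (Real.exp 1 * Real.exp (-|t| / 2)) *
          (Real.exp 1 * Real.exp (-|t| / 2)) := by
        gcongr; exact sechKer_le t
    _ = Real.exp 1 * Real.exp 1 *
          (Real.exp (-|t| / 2) * Real.exp (-|t| / 2) * Real.exp (-|t| / 2)) := by ring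
    _ = _ := by rw [← Real.exp_add (-|t| / 2), ← Real.exp_add (-|t| / 2 + -|t| / 2)]; ring_nf

theorem cschKer_of_ne {w : ℂ} (hw : w ≠ 0) : cschKer w = w / (2 * Complex.sinh (w / 2)) := by
  unfold cschKer
  rw [dslope_of_ne _ (by simpa using hw), slope_def_field]
  simp only [Complex.sinh_zero, sub_zero, inv_div]
  rw [div_div]

theorem sinh_ne_zero {w : ℂ} (h0 : w ≠ 0) (h : |w.im| < Real.pi) : Complex.sinh w ≠ 0 := by
  intro hs
  have h1 : Complex.sin (w * Complex.I) = 0 := by rw [Complex.sin_mul_I, hs, zero_mul]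
  obtain ⟨k, hk⟩ := Complex.sin_eq_zero_iff.1 h1
  have hre := congrArg Complex.re hk
  have him := congrArg Complex.im hk
  simp at hre him
  have hk0 : k = 0 := by
    by_contra hk0
    have : (1 : ℝ) ≤ |(k : ℝ)| := by exact_mod_cast Int.one_le_abs hk0
    have h2 : |w.im| = |(k : ℝ)| * Real.pi := by
      rw [← abs_neg, hre, abs_mul, abs_of_pos Real.pi_pos]
    nlinarith [Real.pi_pos]
  rw [hk0] at hre
  exact h0 (Complex.ext (by simpa using him) (by simpa using hre))

theorem dslope_sinh_ne_zero {w : ℂ} (h : |w.im| < Real.pi) : dslope Complex.sinh 0 w ≠ 0 := by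
  rcases eq_or_ne w 0 with rfl | h0
  · rw [dslope_same]; simp
  · rw [dslope_of_ne _ h0, slope_def_field]
    simpa [h0] using sinh_ne_zero h0 h

theorem differentiable_dslope_sinh : Differentiable ℂ (dslope Complex.sinh 0) := by
  rw [← differentiableOn_univ, Complex.differentiableOn_dslope Filter.univ_mem]
  exact Complex.differentiable_sinh.differentiableOn

theorem differentiableAt_cschKer {w : ℂ} (h : |w.im| < 2 * Real.pi) :
    DifferentiableAt ℂ cschKer w := by
  unfold cschKer
  refine DifferentiableAt.inv ?_ (dslope_sinh_ne_zero ?_)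
  · exact (differentiable_dslope_sinh _).comp w (by fun_prop)
  · have : (w / 2).im = w.im / 2 := by simp
    rw [this, abs_div, abs_two]; linarith

theorem differentiableAt_diffCschKer {w : ℂ} (h : |w.im| < 2 * Real.pi) :
    DifferentiableAt ℂ diffCschKer w := by
  have h1 : DifferentiableAt ℂ (fun w => cschKer (w + 2)) w :=
    DifferentiableAt.comp (g := cschKer) (f := fun w => w + 2) w
      (differentiableAt_cschKer (w := w + 2) (by simpa using h)) (by fun_prop)
  have h2 : DifferentiableAt ℂ (fun w => cschKer (w - 2)) w :=
    DifferentiableAt.comp (g := cschKer) (f := fun w => w - 2) w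
      (differentiableAt_cschKer (w := w - 2) (by simpa using h)) (by fun_prop)
  have h3 := differentiableAt_cschKer h
  exact (h1.add h2).sub (h3.const_mul _)

theorem cschKer_add_sub_pi (u : ℝ) :
    cschKer (u + Real.pi * Complex.I) + cschKer (u - Real.pi * Complex.I) =
      2 * Real.pi * sechKer u := by
  have hpi := Real.pi_pos.ne'
  have n1 : (u : ℂ) + Real.pi * Complex.I ≠ 0 := fun h => by
    have := congrArg Complex.im h; simp [hpi] at this
  have n2 : (u : ℂ) - Real.pi * Complex.I ≠ 0 := fun h => by
    have := congrArg Complex.im h; simp [hpi] at this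
  rw [cschKer_of_ne n1, cschKer_of_ne n2]
  have e1 : Complex.sinh ((u + Real.pi * Complex.I) / 2) = Complex.I * Complex.cosh (u / 2) := by
    have : ((u : ℂ) + Real.pi * Complex.I) / 2 = u / 2 + (Real.pi / 2 : ℂ) * Complex.I := by ring
    rw [this, Complex.sinh_add, Complex.sinh_mul_I, Complex.cosh_mul_I, Complex.sin_pi_div_two,
      Complex.cos_pi_div_two]
    ring
  have e2 : Complex.sinh ((u - Real.pi * Complex.I) / 2) = -Complex.I * Complex.cosh (u / 2) := by
    have : ((u : ℂ) - Real.pi * Complex.I) / 2 = u / 2 - (Real.pi / 2 : ℂ) * Complex.I := by ring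
    rw [this, Complex.sinh_sub, Complex.sinh_mul_I, Complex.cosh_mul_I, Complex.sin_pi_div_two,
      Complex.cos_pi_div_two]
    ring
  have hc : Complex.cosh (u / 2) ≠ 0 := by
    have := (Real.cosh_pos (u / 2)).ne'
    have h2 : ((Real.cosh (u / 2) : ℝ) : ℂ) ≠ 0 := by exact_mod_cast this
    simpa using h2
  rw [e1, e2]
  unfold sechKer
  push_cast
  field_simp
  ring_nf

theorem diffCschKer_add_sub_pi (u : ℝ) :
    diffCschKer (u + Real.pi * Complex.I) + diffCschKer (u - Real.pi * Complex.I) =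
      2 * Real.pi * diffKer u := by
  have h0 := cschKer_add_sub_pi u
  have h1 := cschKer_add_sub_pi (u + 2)
  have h2 := cschKer_add_sub_pi (u - 2)
  push_cast at h1 h2
  unfold diffCschKer diffKer
  rw [show (u : ℂ) + Real.pi * Complex.I + 2 = u + 2 + Real.pi * Complex.I by ring,
    show (u : ℂ) + Real.pi * Complex.I - 2 = u - 2 + Real.pi * Complex.I by ring,
    show (u : ℂ) - Real.pi * Complex.I + 2 = u + 2 - Real.pi * Complex.I by ring,
    show (u : ℂ) - Real.pi * Complex.I - 2 = u - 2 - Real.pi * Complex.I by ring]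
  push_cast
  linear_combination h1 + h2 - 2 * Complex.cosh 1 * h0

theorem diffCschKer_eq {w : ℂ} (hw : 2 < |w.re|) :
    diffCschKer w = (Complex.cosh 1 * Complex.sinh 1 ^ 2 * w / Complex.sinh (w / 2)
      - 2 * Complex.cosh (w / 2) * Complex.sinh 1) /
      (Complex.sinh (w / 2 + 1) * Complex.sinh (w / 2 - 1)) := by
  have key : ∀ z : ℂ, z.re ≠ 0 → Complex.sinh z ≠ 0 := by
    intro z hz hs
    have h1 : Complex.sin (z * Complex.I) = 0 := by rw [Complex.sin_mul_I, hs, zero_mul]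
    obtain ⟨k, hk⟩ := Complex.sin_eq_zero_iff.1 h1
    have him := congrArg Complex.im hk
    simp at him
    exact hz him
  have r0 : w.re ≠ 0 := by intro h; rw [h] at hw; norm_num at hw
  have r1 : w.re + 2 ≠ 0 := by
    intro h; rw [show w.re = -2 by linarith] at hw; norm_num at hw
  have r2 : w.re - 2 ≠ 0 := by
    intro h; rw [show w.re = 2 by linarith] at hw; norm_num at hw
  have e1 : (w + 2) / 2 = w / 2 + 1 := by ring
  have e2 : (w - 2) / 2 = w / 2 - 1 := by ring
  have w0 : w ≠ 0 := fun h => r0 (by simp [h])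
  have w1 : w + 2 ≠ 0 := fun h => r1 (by simpa using congrArg Complex.re h)
  have w2 : w - 2 ≠ 0 := fun h => r2 (by simpa using congrArg Complex.re h)
  have s0 := key (w / 2) (by simpa using r0)
  have s1 := key (w / 2 + 1) (by simp; intro h; apply r1; linarith)
  have s2 := key (w / 2 - 1) (by simp; intro h; apply r2; linarith)
  unfold diffCschKer
  rw [cschKer_of_ne w0, cschKer_of_ne w1, cschKer_of_ne w2, e1, e2]
  have h4 : Complex.sinh (w / 2 + 1) + Complex.sinh (w / 2 - 1) =
      2 * Complex.sinh (w / 2) * Complex.cosh 1 := by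
    rw [Complex.sinh_add, Complex.sinh_sub]; ring
  have h6 : Complex.sinh (w / 2 + 1) - Complex.sinh (w / 2 - 1) =
      2 * Complex.cosh (w / 2) * Complex.sinh 1 := by
    rw [Complex.sinh_add, Complex.sinh_sub]; ring
  have h5 : Complex.sinh (w / 2 + 1) * Complex.sinh (w / 2 - 1) =
      Complex.sinh (w / 2) ^ 2 - Complex.sinh 1 ^ 2 := by
    rw [Complex.sinh_add, Complex.sinh_sub]
    linear_combination Complex.sinh (w / 2) ^ 2 * Complex.cosh_sq 1 -
      Complex.sinh 1 ^ 2 * Complex.cosh_sq (w / 2)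
  push_cast
  generalize Complex.sinh (w / 2) = x at *
  generalize Complex.sinh (w / 2 + 1) = y at *
  generalize Complex.sinh (w / 2 - 1) = z at *
  field_simp
  linear_combination w * x * h4 - 2 * x * h6 - 2 * w * Complex.cosh 1 * h5

theorem exp_abs_re_le_four_mul_norm_sinh {z : ℂ} (hz : 1 ≤ |z.re|) :
    Real.exp |z.re| ≤ 4 * ‖Complex.sinh z‖ := by
  have h1 : |‖Complex.exp z‖ - ‖Complex.exp (-z)‖| ≤ ‖Complex.exp z - Complex.exp (-z)‖ :=
    abs_norm_sub_norm_le _ _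
  have h2 : ‖Complex.exp z - Complex.exp (-z)‖ = 2 * ‖Complex.sinh z‖ := by
    rw [← Complex.two_sinh, norm_mul]; simp
  rw [h2, Complex.norm_exp, Complex.norm_exp, Complex.neg_re] at h1
  have h3 : Real.exp (-|z.re|) * 2 ≤ Real.exp |z.re| := by
    have a1 : (2 : ℝ) ≤ Real.exp (2 * |z.re|) := by
      have := Real.add_one_le_exp (2 * |z.re|); linarith
    have a2 : Real.exp |z.re| = Real.exp (-|z.re|) * Real.exp (2 * |z.re|) := by
      rw [← Real.exp_add]; ring_nf
    rw [a2]
    exact mul_le_mul_of_nonneg_left a1 (Real.exp_pos _).le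
  rcases abs_cases z.re with ⟨h, -⟩ | ⟨h, -⟩
  · rw [h] at h3 ⊢
    have := le_of_abs_le h1
    linarith
  · rw [h, neg_neg] at h3
    rw [h]
    have := neg_le_of_abs_le h1
    linarith

theorem norm_cosh_le_exp_abs_re (z : ℂ) : ‖Complex.cosh z‖ ≤ Real.exp |z.re| := by
  have h1 : ‖Complex.exp z + Complex.exp (-z)‖ = 2 * ‖Complex.cosh z‖ := by
    rw [← Complex.two_cosh, norm_mul]; simp
  have h2 := norm_add_le (Complex.exp z) (Complex.exp (-z))
  rw [h1, Complex.norm_exp, Complex.norm_exp, Complex.neg_re] at h2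
  have h3 : Real.exp z.re ≤ Real.exp |z.re| := Real.exp_le_exp.2 (le_abs_self _)
  have h4 : Real.exp (-z.re) ≤ Real.exp |z.re| := Real.exp_le_exp.2 (neg_le_abs _)
  linarith

theorem norm_diffCschKer_le_of_four_le {w : ℂ} (h4 : 4 ≤ |w.re|)
    (him : |w.im| ≤ 3 / 2 * Real.pi) :
    ‖diffCschKer w‖ ≤ 16 * Real.exp 2 *
      (20 * ‖Complex.cosh 1 * Complex.sinh 1 ^ 2‖ + 2 * ‖Complex.sinh 1‖) *
        Real.exp (-|w.re| / 2) := by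
  rw [diffCschKer_eq (by linarith), norm_div]
  set r := |w.re| / 2 with hr
  have hr2 : 2 ≤ r := by linarith
  have hre : (w / 2).re = w.re / 2 := by simp
  have habs : |(w / 2).re| = r := by rw [hre, abs_div, abs_two]
  have s0 := exp_abs_re_le_four_mul_norm_sinh (z := w / 2) (by rw [habs]; linarith)
  rw [habs] at s0
  have t1 : r - 1 ≤ |(w / 2 + 1).re| := by
    have := abs_sub_abs_le_abs_sub (w / 2).re (-1)
    rw [habs] at this; norm_num at this ⊢; linarith
  have t2 : r - 1 ≤ |(w / 2 - 1).re| := by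
    have := abs_sub_abs_le_abs_sub (w / 2).re 1
    rw [habs] at this; norm_num at this ⊢; linarith
  have s1 := exp_abs_re_le_four_mul_norm_sinh (z := w / 2 + 1) (by linarith)
  have s2 := exp_abs_re_le_four_mul_norm_sinh (z := w / 2 - 1) (by linarith)
  have s1' := (Real.exp_le_exp.2 t1).trans s1
  have s2' := (Real.exp_le_exp.2 t2).trans s2
  have hden : Real.exp r * Real.exp r ≤
      16 * Real.exp 2 * ‖Complex.sinh (w / 2 + 1) * Complex.sinh (w / 2 - 1)‖ := by
    have : Real.exp r * Real.exp r = Real.exp 2 * (Real.exp (r - 1) * Real.exp (r - 1)) := by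
      rw [← Real.exp_add, ← Real.exp_add, ← Real.exp_add]; ring_nf
    rw [this, norm_mul]
    have h := mul_le_mul s1' s2' (Real.exp_pos _).le (by positivity)
    have := mul_le_mul_of_nonneg_left h (Real.exp_pos 2).le
    linarith
  have hdenpos : 0 < ‖Complex.sinh (w / 2 + 1) * Complex.sinh (w / 2 - 1)‖ := by
    by_contra hn
    have := mul_pos (Real.exp_pos r) (Real.exp_pos r)
    nlinarith [Real.exp_pos 2]
  have hs0 : 0 < ‖Complex.sinh (w / 2)‖ := by linarith [Real.exp_pos r]
  have hw : ‖w‖ ≤ 5 * (Real.exp r * Real.exp r) := by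
    have h1 := Complex.norm_le_abs_re_add_abs_im w
    have h2 := Real.pi_lt_d2
    have h3 := Real.add_one_le_exp r
    nlinarith
  have hq : ‖w‖ / ‖Complex.sinh (w / 2)‖ ≤ 20 * Real.exp r := by
    rw [div_le_iff₀ hs0]
    nlinarith [Real.exp_pos r]
  have hcosh := norm_cosh_le_exp_abs_re (w / 2)
  rw [habs] at hcosh
  have hnum : ‖Complex.cosh 1 * Complex.sinh 1 ^ 2 * w / Complex.sinh (w / 2)
      - 2 * Complex.cosh (w / 2) * Complex.sinh 1‖ ≤
      (20 * ‖Complex.cosh 1 * Complex.sinh 1 ^ 2‖ + 2 * ‖Complex.sinh 1‖) * Real.exp r := by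
    refine (norm_sub_le _ _).trans ?_
    rw [norm_div, norm_mul _ w, norm_mul _ (Complex.sinh 1), norm_mul 2, mul_div_assoc]
    have := mul_le_mul_of_nonneg_left hq (norm_nonneg (Complex.cosh 1 * Complex.sinh 1 ^ 2))
    have h2 := mul_le_mul_of_nonneg_right hcosh (norm_nonneg (Complex.sinh 1))
    simp only [Complex.norm_ofNat]
    linarith
  rw [div_le_iff₀ hdenpos]
  refine hnum.trans ?_
  have e : Real.exp (-|w.re| / 2) = (Real.exp r)⁻¹ := by rw [← Real.exp_neg, hr, neg_div]
  rw [e]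
  set K := 20 * ‖Complex.cosh 1 * Complex.sinh 1 ^ 2‖ + 2 * ‖Complex.sinh 1‖ with hK
  have hK0 : 0 ≤ K := by positivity
  calc K * Real.exp r = K * (Real.exp r)⁻¹ * (Real.exp r * Real.exp r) := by
        field_simp
    _ ≤ K * (Real.exp r)⁻¹ * (16 * Real.exp 2 *
          ‖Complex.sinh (w / 2 + 1) * Complex.sinh (w / 2 - 1)‖) := by gcongr
    _ = _ := by ring

theorem exists_norm_diffCschKer_le : ∃ C, 0 ≤ C ∧ ∀ w : ℂ, |w.im| ≤ 3 / 2 * Real.pi →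
    ‖diffCschKer w‖ ≤ C * Real.exp (-|w.re| / 2) := by
  have hcpt : IsCompact (Icc (-4 : ℝ) 4 ×ℂ Icc (-(3 / 2 * Real.pi)) (3 / 2 * Real.pi)) :=
    isCompact_Icc.reProdIm isCompact_Icc
  have hcont : ContinuousOn diffCschKer
      (Icc (-4 : ℝ) 4 ×ℂ Icc (-(3 / 2 * Real.pi)) (3 / 2 * Real.pi)) := by
    intro w hw
    refine (differentiableAt_diffCschKer ?_).continuousAt.continuousWithinAt
    have := abs_le.2 hw.2
    linarith [Real.pi_pos]
  obtain ⟨C, hC⟩ := hcpt.exists_bound_of_continuousOn hcont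
  set C' := 16 * Real.exp 2 *
      (20 * ‖Complex.cosh 1 * Complex.sinh 1 ^ 2‖ + 2 * ‖Complex.sinh 1‖)
  refine ⟨max C' (C * Real.exp 2), le_max_of_le_left (by positivity), fun w hw => ?_⟩
  rcases le_total 4 |w.re| with h | h
  · refine (norm_diffCschKer_le_of_four_le h hw).trans ?_
    gcongr
    exact le_max_left _ _
  · have hb := hC w ⟨abs_le.1 h, abs_le.1 hw⟩
    have hC0 : 0 ≤ C := (norm_nonneg _).trans hb
    calc ‖diffCschKer w‖ ≤ C * 1 := by simpa using hb
      _ ≤ C * (Real.exp 2 * Real.exp (-|w.re| / 2)) := by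
        gcongr
        rw [← Real.exp_add]
        apply Real.one_le_exp
        linarith
      _ = C * Real.exp 2 * Real.exp (-|w.re| / 2) := by ring
      _ ≤ _ := by gcongr; exact le_max_right _ _

theorem integrable_exp_neg_mul_abs {a : ℝ} (ha : 0 < a) :
    Integrable (fun t : ℝ => Real.exp (-a * |t|)) := by
  rw [← integrableOn_univ, ← Iic_union_Ioi (a := (0 : ℝ)), integrableOn_union]
  constructor
  · refine (integrableOn_exp_mul_Iic ha 0).congr_fun (fun t ht => ?_) measurableSet_Iic
    simp only [abs_of_nonpos (mem_Iic.1 ht)]; ring_nf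
  · refine (integrableOn_exp_mul_Ioi (neg_lt_zero.2 ha) 0).congr_fun (fun t ht => ?_)
      measurableSet_Ioi
    simp only [abs_of_pos (mem_Ioi.1 ht)]

theorem integrable_sechKer : Integrable sechKer := by
  refine (integrable_exp_neg_mul_abs (a := 1 / 2) (by norm_num)).mono'
    continuous_sechKer.aestronglyMeasurable (Filter.Eventually.of_forall fun t => ?_)
  rw [Real.norm_of_nonneg (sechKer_pos t).le]
  refine (sechKer_le t).trans_eq ?_
  ring_nf

theorem integrable_sechKer_mul (u c : ℝ) :
    Integrable fun t => sechKer (t + c) * sechKer (u - t) := by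
  have := continuous_sechKer
  refine (integrable_sechKer.comp_add_right c).mono' (by fun_prop)
    (Filter.Eventually.of_forall fun t => ?_)
  rw [Real.norm_of_nonneg (mul_nonneg (sechKer_pos _).le (sechKer_pos _).le)]
  refine mul_le_of_le_one_right (sechKer_pos _).le ((sechKer_le _).trans ?_)
  rw [Real.exp_le_one_iff]
  linarith [abs_nonneg (u - t)]

theorem tendsto_log_cosh_sub (c : ℝ) : Filter.Tendsto
    (fun t => Real.log (Real.cosh t) - Real.log (Real.cosh (c - t))) Filter.atTop (nhds c) := by
  have h1 : Filter.Tendsto (fun t : ℝ => Real.log (1 + Real.exp (-2 * t)) -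
      Real.log (1 + Real.exp (2 * c) * Real.exp (-2 * t)) + c) Filter.atTop (nhds c) := by
    have e0 : Filter.Tendsto (fun t : ℝ => Real.exp (-2 * t)) Filter.atTop (nhds 0) :=
      Real.tendsto_exp_atBot.comp
        (Filter.tendsto_id.const_mul_atTop_of_neg (by norm_num : (-2 : ℝ) < 0))
    have e1 : Filter.Tendsto (fun t : ℝ => 1 + Real.exp (-2 * t)) Filter.atTop (nhds 1) := by
      simpa using e0.const_add 1
    have e2 : Filter.Tendsto (fun t : ℝ => 1 + Real.exp (2 * c) * Real.exp (-2 * t))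
        Filter.atTop (nhds 1) := by
      simpa using (e0.const_mul (Real.exp (2 * c))).const_add 1
    have := ((e1.log one_ne_zero).sub (e2.log one_ne_zero)).add_const c
    simpa using this
  refine h1.congr fun t => ?_
  have p1 : Real.cosh t = (1 + Real.exp (-2 * t)) * (Real.exp t / 2) := by
    rw [Real.cosh_eq]
    have : Real.exp (-t) = Real.exp (-2 * t) * Real.exp t := by rw [← Real.exp_add]; ring_nf
    rw [this]; ring
  have p2 : Real.cosh (c - t) =
      (1 + Real.exp (2 * c) * Real.exp (-2 * t)) * (Real.exp (t - c) / 2) := by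
    rw [Real.cosh_eq]
    have : Real.exp (c - t) = Real.exp (2 * c) * Real.exp (-2 * t) * Real.exp (t - c) := by
      rw [← Real.exp_add, ← Real.exp_add]; ring_nf
    rw [this, neg_sub]; ring
  rw [p1, p2, Real.log_mul (by positivity) (by positivity),
    Real.log_mul (by positivity) (by positivity), Real.log_div (by positivity) (by norm_num),
    Real.log_div (by positivity) (by norm_num), Real.log_exp, Real.log_exp]
  ring

theorem integral_sechKer_mul_sechKer {u : ℝ} (hu : u ≠ 0) :
    ∫ t, sechKer t * sechKer (u - t) = u / (2 * Real.sinh (u / 2)) := by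
  have hs : Real.sinh (u / 2) ≠ 0 := by rw [Ne, Real.sinh_eq_zero]; simpa using hu
  have hder : ∀ t : ℝ, HasDerivAt
      (fun t => (Real.log (Real.cosh (t / 2)) - Real.log (Real.cosh (u / 2 - t / 2))) /
        (2 * Real.sinh (u / 2))) (sechKer t * sechKer (u - t)) t := by
    intro t
    have c1 := (Real.cosh_pos (t / 2)).ne'
    have c2 := (Real.cosh_pos (u / 2 - t / 2)).ne'
    have d1 : HasDerivAt (fun t : ℝ => t / 2) (1 / 2) t := (hasDerivAt_id t).div_const 2
    have d2 : HasDerivAt (fun t : ℝ => u / 2 - t / 2) (-(1 / 2)) t := d1.const_sub _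
    have h := ((d1.cosh.log c1).sub (d2.cosh.log c2)).div_const (2 * Real.sinh (u / 2))
    refine h.congr_deriv ?_
    unfold sechKer
    have e : (u - t) / 2 = u / 2 - t / 2 := by ring
    rw [e]
    have key : Real.sinh (t / 2) * Real.cosh (u / 2 - t / 2) +
        Real.cosh (t / 2) * Real.sinh (u / 2 - t / 2) = Real.sinh (u / 2) := by
      rw [← Real.sinh_add]; ring_nf
    generalize Real.cosh (t / 2) = x at *
    generalize Real.cosh (u / 2 - t / 2) = y at *
    generalize Real.sinh (t / 2) = x' at *
    generalize Real.sinh (u / 2 - t / 2) = y' at *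
    generalize Real.sinh (u / 2) = s at *
    field_simp
    linear_combination key
  have hhalf : Filter.Tendsto (fun t : ℝ => t / 2) Filter.atTop Filter.atTop :=
    Filter.tendsto_id.atTop_div_const (by norm_num)
  have htop := ((tendsto_log_cosh_sub (u / 2)).comp hhalf).div_const (2 * Real.sinh (u / 2))
  have hbot : Filter.Tendsto
      (fun t => (Real.log (Real.cosh (t / 2)) - Real.log (Real.cosh (u / 2 - t / 2))) /
        (2 * Real.sinh (u / 2))) Filter.atBot (nhds (-(u / 2) / (2 * Real.sinh (u / 2)))) := by
    have h := ((tendsto_log_cosh_sub (-(u / 2))).comp hhalf).div_const (2 * Real.sinh (u / 2))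
    refine (h.comp Filter.tendsto_neg_atBot_atTop).congr fun t => ?_
    simp only [Function.comp]
    rw [neg_div, Real.cosh_neg, ← Real.cosh_neg (u / 2 - t / 2)]
    ring_nf
  have hker : Integrable fun t => sechKer t * sechKer (u - t) := by
    simpa using integrable_sechKer_mul u 0
  rw [integral_of_hasDerivAt_of_tendsto hder hker hbot htop]
  field_simp
  ring

theorem integral_sechKer_mul_sechKer_eq_cschKer {u : ℝ} (hu : u ≠ 0) :
    ((∫ t, sechKer t * sechKer (u - t) : ℝ) : ℂ) = cschKer u := by
  rw [integral_sechKer_mul_sechKer hu, cschKer_of_ne (by exact_mod_cast hu)]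
  push_cast; rfl

theorem integral_diffKer_mul_sechKer {u : ℝ} (h0 : u ≠ 0) (h1 : u ≠ 2) (h2 : u ≠ -2) :
    ((∫ t, diffKer t * sechKer (u - t) : ℝ) : ℂ) = diffCschKer u := by
  have hshift : ∀ c : ℝ, ∫ t, sechKer (t + c) * sechKer (u - t) =
      ∫ t, sechKer t * sechKer (u + c - t) := by
    intro c
    rw [← integral_add_right_eq_self (fun t => sechKer t * sechKer (u + c - t)) c]
    congr 1; ext t; ring_nf
  have hsplit : ∫ t, diffKer t * sechKer (u - t) =
      (∫ t, sechKer (t + 2) * sechKer (u - t)) + (∫ t, sechKer (t + -2) * sechKer (u - t)) -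
        2 * Real.cosh 1 * ∫ t, sechKer (t + 0) * sechKer (u - t) := by
    rw [← integral_const_mul, ← integral_add (integrable_sechKer_mul u 2)
      (integrable_sechKer_mul u (-2)), ← integral_sub]
    · congr 1; ext t; unfold diffKer; ring_nf
    · exact (integrable_sechKer_mul u 2).add (integrable_sechKer_mul u (-2))
    · exact (integrable_sechKer_mul u 0).const_mul _
  rw [hsplit, hshift, hshift, hshift]
  have g0 := integral_sechKer_mul_sechKer_eq_cschKer (u := u + 0) (by simpa)
  have g1 := integral_sechKer_mul_sechKer_eq_cschKer (u := u + 2)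
    (fun h => h2 (by linarith))
  have g2 := integral_sechKer_mul_sechKer_eq_cschKer (u := u + -2)
    (fun h => h1 (by linarith))
  push_cast
  rw [g0, g1, g2]
  unfold diffCschKer
  push_cast
  ring_nf

/-- The holomorphic extension of (a multiple of) the second order difference of a solution. -/
def stripExt (G : ℝ → ℂ) (w : ℂ) : ℂ := ∫ v : ℝ, G v * diffCschKer (w - v)

section StripExt

variable {G : ℝ → ℂ}

theorem exp_neg_abs_sub_le (x v : ℝ) :
    Real.exp (-|x - v| / 2) ≤ Real.exp (|x| / 2) * Real.exp (-|v| / 2) := by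
  rw [← Real.exp_add, Real.exp_le_exp]
  have := abs_sub_abs_le_abs_sub v x
  rw [abs_sub_comm v x] at this
  linarith

theorem continuous_diffCschKer_sub {w : ℂ} (hw : |w.im| < 2 * Real.pi) :
    Continuous fun v : ℝ => diffCschKer (w - v) := by
  rw [continuous_iff_continuousAt]
  intro v
  exact ContinuousAt.comp (f := fun v : ℝ => w - v) (g := diffCschKer)
    (differentiableAt_diffCschKer (by simpa using hw)).continuousAt (by fun_prop)

theorem differentiableAt_stripExt (hm : AEStronglyMeasurable G)
    (hG : Integrable fun v => ‖G v‖ * Real.exp (-|v| / 2)) {w₀ : ℂ}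
    (hw₀ : |w₀.im| < 3 / 2 * Real.pi) : DifferentiableAt ℂ (stripExt G) w₀ := by
  obtain ⟨C, hC0, hC⟩ := exists_norm_diffCschKer_le
  have hpi := Real.pi_pos
  set δ := (3 / 2 * Real.pi - |w₀.im|) / 2 with hδ
  have hδ0 : 0 < δ := by rw [hδ]; linarith
  have hstrip : ∀ z : ℂ, ‖z - w₀‖ ≤ 2 * δ → |z.im| ≤ 3 / 2 * Real.pi := by
    intro z hz
    have h1 := (Complex.abs_im_le_norm (z - w₀)).trans hz
    rw [Complex.sub_im] at h1
    have h2 := abs_sub_abs_le_abs_sub z.im w₀.im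
    rw [hδ] at h1
    linarith
  have hbound : ∀ z : ℂ, ‖z - w₀‖ ≤ 2 * δ → ∀ v : ℝ, ‖diffCschKer (z - v)‖ ≤
      C * (Real.exp ((|w₀.re| + 2 * δ) / 2) * Real.exp (-|v| / 2)) := by
    intro z hz v
    refine (hC (z - v) (by simpa using hstrip z hz)).trans ?_
    have h1 := (Complex.abs_re_le_norm (z - w₀)).trans hz
    rw [Complex.sub_re] at h1
    have h2 := abs_sub_abs_le_abs_sub z.re w₀.re
    have h3 := exp_neg_abs_sub_le z.re v
    simp only [Complex.sub_re, Complex.ofReal_re]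
    refine mul_le_mul_of_nonneg_left (h3.trans ?_) hC0
    gcongr
    linarith
  have key := hasDerivAt_integral_of_dominated_loc_of_deriv_le (μ := volume)
    (F := fun (w : ℂ) (v : ℝ) => G v * diffCschKer (w - v))
    (F' := fun (w : ℂ) (v : ℝ) => G v * deriv diffCschKer (w - v)) (x₀ := w₀)
    (bound := fun v => C * Real.exp ((|w₀.re| + 2 * δ) / 2) / δ * (‖G v‖ * Real.exp (-|v| / 2)))
    (Metric.ball_mem_nhds w₀ hδ0) ?_ ?_ ?_ ?_ ?_ ?_
  · exact key.2.differentiableAt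
  · filter_upwards [Metric.closedBall_mem_nhds w₀ (show 0 < 2 * δ by positivity)] with z hz
    refine hm.mul (continuous_diffCschKer_sub ?_).aestronglyMeasurable
    have := hstrip z (by simpa [dist_eq_norm] using hz)
    linarith
  · refine (hG.const_mul (C * Real.exp ((|w₀.re| + 2 * δ) / 2))).mono'
      (hm.mul (continuous_diffCschKer_sub (by linarith)).aestronglyMeasurable)
      (Filter.Eventually.of_forall fun v => ?_)
    rw [norm_mul]
    have := hbound w₀ (by simp; positivity) v
    calc _ ≤ ‖G v‖ * (C * (Real.exp ((|w₀.re| + 2 * δ) / 2) * Real.exp (-|v| / 2))) := by gcongr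
      _ = _ := by ring
  · refine hm.mul ((measurable_deriv diffCschKer).comp ?_).aestronglyMeasurable
    fun_prop
  · refine Filter.Eventually.of_forall fun v w hw => ?_
    have hw' : ‖w - w₀‖ < δ := by simpa [dist_eq_norm] using hw
    have hcl : ∀ z : ℂ, ‖z - (w - v)‖ ≤ δ → ‖(z + v) - w₀‖ ≤ 2 * δ := by
      intro z hz
      have := norm_add_le (z - (w - v)) (w - w₀)
      rw [show z - (w - v) + (w - w₀) = z + v - w₀ by ring] at this
      linarith
    have hd := Complex.norm_deriv_le_of_forall_mem_sphere_norm_le (c := w - v) (R := δ)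
      (C := C * (Real.exp ((|w₀.re| + 2 * δ) / 2) * Real.exp (-|v| / 2))) (f := diffCschKer) hδ0 ?_ ?_
    · rw [norm_mul]
      calc _ ≤ ‖G v‖ * (C * (Real.exp ((|w₀.re| + 2 * δ) / 2) * Real.exp (-|v| / 2)) / δ) := by
            gcongr
        _ = _ := by ring
    · apply DifferentiableOn.diffContOnCl
      rw [closure_ball _ hδ0.ne']
      intro z hz
      apply (differentiableAt_diffCschKer _).differentiableWithinAt
      have := hstrip _ (hcl z (by simpa [dist_eq_norm] using hz))
      simp at this
      linarith
    · intro z hz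
      have hz' : ‖z - (w - v)‖ = δ := by simpa [dist_eq_norm] using hz
      simpa using hbound (z + v) (hcl z hz'.le) v
  · exact hG.const_mul _
  · refine Filter.Eventually.of_forall fun v w hw => ?_
    have hw' : ‖w - w₀‖ < δ := by simpa [dist_eq_norm] using hw
    have := hstrip w (by linarith)
    refine HasDerivAt.const_mul _ (HasDerivAt.comp_sub_const w (v : ℂ) ?_)
    apply (differentiableAt_diffCschKer _).hasDerivAt
    simp only [Complex.sub_im, Complex.ofReal_im, sub_zero]
    linarith

theorem exists_norm_stripExt_le (hG : Integrable fun v => ‖G v‖ * Real.exp (-|v| / 2)) :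
    ∃ C, 0 ≤ C ∧ ∀ w : ℂ, |w.im| ≤ 3 / 2 * Real.pi →
      ‖stripExt G w‖ ≤ C * Real.exp (|w.re| / 2) := by
  obtain ⟨C, hC0, hC⟩ := exists_norm_diffCschKer_le
  refine ⟨C * ∫ v, ‖G v‖ * Real.exp (-|v| / 2), ?_, fun w hw => ?_⟩
  · exact mul_nonneg hC0 (integral_nonneg fun v => by positivity)
  · have := norm_integral_le_of_norm_le (μ := volume) (f := fun v : ℝ => G v * diffCschKer (w - v))
      (g := fun v => C * Real.exp (|w.re| / 2) * (‖G v‖ * Real.exp (-|v| / 2)))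
      (hG.const_mul _) (Filter.Eventually.of_forall fun v => ?_)
    · rw [integral_const_mul] at this
      unfold stripExt
      linarith
    · have h1 := hC (w - v) (by simpa using hw)
      have h2 := exp_neg_abs_sub_le w.re v
      simp only [Complex.sub_re, Complex.ofReal_re] at h1
      rw [norm_mul]
      calc _ ≤ ‖G v‖ * (C * (Real.exp (|w.re| / 2) * Real.exp (-|v| / 2))) := by
            gcongr; exact h1.trans (by gcongr)
        _ = _ := by ring

theorem integrable_mul_diffCschKer (hm : AEStronglyMeasurable G)
    (hG : Integrable fun v => ‖G v‖ * Real.exp (-|v| / 2)) {w : ℂ}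
    (hw : |w.im| ≤ 3 / 2 * Real.pi) : Integrable fun v : ℝ => G v * diffCschKer (w - v) := by
  obtain ⟨C, hC0, hC⟩ := exists_norm_diffCschKer_le
  refine (hG.const_mul (C * Real.exp (|w.re| / 2))).mono'
    (hm.mul (continuous_diffCschKer_sub (by linarith [Real.pi_pos])).aestronglyMeasurable)
    (Filter.Eventually.of_forall fun v => ?_)
  have h1 := hC (w - v) (by simpa using hw)
  have h2 := exp_neg_abs_sub_le w.re v
  simp only [Complex.sub_re, Complex.ofReal_re] at h1
  rw [norm_mul]
  calc _ ≤ ‖G v‖ * (C * (Real.exp (|w.re| / 2) * Real.exp (-|v| / 2))) := by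
        gcongr; exact h1.trans (by gcongr)
    _ = _ := by ring

theorem integrable_mul_sechKer (hm : AEStronglyMeasurable G)
    (hG : Integrable fun v => ‖G v‖ * Real.exp (-|v| / 2)) (u : ℝ) :
    Integrable fun v : ℝ => G v * (sechKer (u - v) : ℂ) := by
  have := continuous_sechKer
  refine (hG.const_mul (Real.exp (|u| / 2))).mono' (hm.mul (by fun_prop))
    (Filter.Eventually.of_forall fun v => ?_)
  rw [norm_mul, Complex.norm_real, Real.norm_of_nonneg (sechKer_pos _).le]
  calc _ ≤ ‖G v‖ * (Real.exp (|u| / 2) * Real.exp (-|v| / 2)) := by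
        gcongr; exact (sechKer_le _).trans (exp_neg_abs_sub_le u v)
    _ = _ := by ring

/-- The second order difference of a function on the line annihilating `exp (± u / 2)`. -/
def secondDiff (G : ℝ → ℂ) (u : ℝ) : ℂ := G (u + 2) + G (u - 2) - 2 * Real.cosh 1 * G u

variable {lam : ℂ}

theorem secondDiff_eq_integral_diffKer (hm : AEStronglyMeasurable G)
    (hG : Integrable fun v => ‖G v‖ * Real.exp (-|v| / 2))
    (heq : ∀ u : ℝ, G u = lam * ∫ v, G v * (sechKer (u - v) : ℂ)) (u : ℝ) :
    secondDiff G u = lam * ∫ v, G v * (diffKer (u - v) : ℂ) := by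
  have hi := integrable_mul_sechKer hm hG
  have : ∫ v, G v * (diffKer (u - v) : ℂ) = (∫ v, G v * (sechKer (u + 2 - v) : ℂ)) +
      (∫ v, G v * (sechKer (u - 2 - v) : ℂ)) -
        2 * Real.cosh 1 * ∫ v, G v * (sechKer (u - v) : ℂ) := by
    rw [← integral_const_mul, ← integral_add (hi _) (hi _), ← integral_sub]
    · congr 1; ext v
      unfold diffKer
      rw [show u - v + 2 = u + 2 - v by ring, show u - v - 2 = u - 2 - v by ring]
      push_cast; ring
    · exact (hi _).add (hi _)
    · exact (hi _).const_mul _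
  unfold secondDiff
  rw [this, heq (u + 2), heq (u - 2), heq u]
  ring

theorem secondDiff_eq_integral_sechKer (hm : AEStronglyMeasurable G)
    (hG : Integrable fun v => ‖G v‖ * Real.exp (-|v| / 2))
    (heq : ∀ u : ℝ, G u = lam * ∫ v, G v * (sechKer (u - v) : ℂ)) (u : ℝ) :
    secondDiff G u = lam * ∫ s, secondDiff G s * (sechKer (u - s) : ℂ) := by
  have hi := integrable_mul_sechKer hm hG
  have hshift : ∀ c : ℝ, Integrable (fun s => G (s + c) * (sechKer (u - s) : ℂ)) ∧
      ∫ s, G (s + c) * (sechKer (u - s) : ℂ) = ∫ v, G v * (sechKer (u + c - v) : ℂ) := by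
    intro c
    have e : (fun s => G (s + c) * (sechKer (u - s) : ℂ)) =
        fun s => (fun v => G v * (sechKer (u + c - v) : ℂ)) (s + c) := by
      ext s; simp only; rw [show u + c - (s + c) = u - s by ring]
    rw [e]
    exact ⟨(hi _).comp_add_right c, 
      integral_add_right_eq_self (fun v => G v * (sechKer (u + c - v) : ℂ)) c⟩
  obtain ⟨i1, h1⟩ := hshift 2
  obtain ⟨i2, h2⟩ := hshift (-2)
  have : ∫ s, secondDiff G s * (sechKer (u - s) : ℂ) =
      (∫ s, G (s + 2) * (sechKer (u - s) : ℂ)) + (∫ s, G (s + -2) * (sechKer (u - s) : ℂ)) -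
        2 * Real.cosh 1 * ∫ v, G v * (sechKer (u - v) : ℂ) := by
    rw [← integral_const_mul, ← integral_add i1 i2, ← integral_sub]
    · congr 1; ext s
      unfold secondDiff
      rw [sub_eq_add_neg s 2]; ring
    · exact i1.add i2
    · exact (hi _).const_mul _
  rw [this, h1, h2]
  unfold secondDiff
  rw [heq (u + 2), heq (u - 2), heq u, ← sub_eq_add_neg]
  ring

theorem integrable_prod_diffKer_sechKer (hm : AEStronglyMeasurable G)
    (hG : Integrable fun v => ‖G v‖ * Real.exp (-|v| / 2)) (u : ℝ) :
    Integrable (fun p : ℝ × ℝ => G p.2 * ((diffKer (p.1 - p.2) * sechKer (u - p.1) : ℝ) : ℂ))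
      (volume.prod volume) := by
  obtain ⟨C, hC0, hC⟩ := exists_abs_diffKer_le
  have c1 := continuous_sechKer
  have c2 := continuous_diffKer
  have hconv := (hG.convolution_integrand (ContinuousLinearMap.mul ℝ ℝ)
    (integrable_exp_neg_mul_abs one_pos)).const_mul (C * Real.exp (|u| / 2))
  refine hconv.mono' ((hm.comp_snd).mul (by fun_prop))
    (Filter.Eventually.of_forall fun p => ?_)
  obtain ⟨s, v⟩ := p
  simp only [ContinuousLinearMap.mul_apply']
  rw [norm_mul, Complex.norm_real, norm_mul, Real.norm_eq_abs, Real.norm_of_nonneg (sechKer_pos _).le]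
  have hexp : Real.exp (-(3 / 2) * |s - v|) * Real.exp (-|u - s| / 2) ≤
      Real.exp (|u| / 2) * Real.exp (-|v| / 2) * Real.exp (-1 * |s - v|) := by
    rw [← Real.exp_add, ← Real.exp_add, ← Real.exp_add, Real.exp_le_exp]
    have h1 := abs_sub_abs_le_abs_sub v s
    have h2 := abs_sub_abs_le_abs_sub s u
    rw [abs_sub_comm v s] at h1
    rw [abs_sub_comm s u] at h2
    linarith
  calc ‖G v‖ * (|diffKer (s - v)| * sechKer (u - s))
      ≤ ‖G v‖ * ((C * Real.exp (-(3 / 2) * |s - v|)) * Real.exp (-|u - s| / 2)) := by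
        have := (sechKer_pos (u - s)).le
        gcongr
        · exact hC _
        · exact sechKer_le _
    _ = ‖G v‖ * C * (Real.exp (-(3 / 2) * |s - v|) * Real.exp (-|u - s| / 2)) := by ring
    _ ≤ ‖G v‖ * C * (Real.exp (|u| / 2) * Real.exp (-|v| / 2) * Real.exp (-1 * |s - v|)) := by
        gcongr
    _ = _ := by ring

theorem secondDiff_eq_stripExt (hm : AEStronglyMeasurable G)
    (hG : Integrable fun v => ‖G v‖ * Real.exp (-|v| / 2))
    (heq : ∀ u : ℝ, G u = lam * ∫ v, G v * (sechKer (u - v) : ℂ)) (u : ℝ) :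
    secondDiff G u = lam ^ 2 * stripExt G u := by
  rw [secondDiff_eq_integral_sechKer hm hG heq]
  have h1 : ∫ s, secondDiff G s * (sechKer (u - s) : ℂ) =
      lam * ∫ s, ∫ v, G v * ((diffKer (s - v) * sechKer (u - s) : ℝ) : ℂ) := by
    rw [← integral_const_mul]
    congr 1; ext s
    rw [secondDiff_eq_integral_diffKer hm hG heq, mul_assoc, ← integral_mul_const]
    congr 2; ext v
    push_cast; ring
  have h2 := integral_integral_swap
    (f := fun s v => G v * ((diffKer (s - v) * sechKer (u - s) : ℝ) : ℂ))
    (integrable_prod_diffKer_sechKer hm hG u)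
  rw [h1, h2, ← mul_assoc, ← sq]
  unfold stripExt
  congr 1
  apply integral_congr_ae
  have hfin : ({u, u - 2, u + 2} : Set ℝ).Finite := by simp
  filter_upwards [hfin.countable.ae_notMem volume] with v hv
  simp only [mem_insert_iff, mem_singleton_iff, not_or] at hv
  obtain ⟨v0, v1, v2⟩ := hv
  rw [integral_const_mul]
  congr 1
  have h3 := integral_diffKer_mul_sechKer (u := u - v) (fun h => v0 (by linarith))
    (fun h => v1 (by linarith)) (fun h => v2 (by linarith))
  push_cast at h3
  rw [← h3, ← integral_add_right_eq_self (fun s => ((diffKer (s - v) * sechKer (u - s) : ℝ) : ℂ)) v,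
    integral_complex_ofReal]
  congr 2
  ext t
  ring_nf

theorem stripExt_add_sub_pi_real (hm : AEStronglyMeasurable G)
    (hG : Integrable fun v => ‖G v‖ * Real.exp (-|v| / 2)) (hlam : lam ≠ 0)
    (heq : ∀ u : ℝ, G u = lam * ∫ v, G v * (sechKer (u - v) : ℂ)) (u : ℝ) :
    stripExt G (u + Real.pi * Complex.I) + stripExt G (u - Real.pi * Complex.I) =
      2 * Real.pi * lam * stripExt G u := by
  have hpi := Real.pi_pos
  have h1 : stripExt G (u + Real.pi * Complex.I) + stripExt G (u - Real.pi * Complex.I) =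
      2 * Real.pi * ∫ v, G v * (diffKer (u - v) : ℂ) := by
    unfold stripExt
    rw [← integral_const_mul, ← integral_add]
    · congr 1; ext v
      have := diffCschKer_add_sub_pi (u - v)
      push_cast at this
      rw [show (u : ℂ) + Real.pi * Complex.I - v = u - v + Real.pi * Complex.I by ring,
        show (u : ℂ) - Real.pi * Complex.I - v = u - v - Real.pi * Complex.I by ring]
      linear_combination G v * this
    · apply integrable_mul_diffCschKer hm hG
      simp [abs_of_pos hpi]; linarith
    · apply integrable_mul_diffCschKer hm hG
      simp [abs_of_pos hpi]; linarith
  have h2 := secondDiff_eq_integral_diffKer hm hG heq u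
  rw [secondDiff_eq_stripExt hm hG heq] at h2
  apply mul_left_cancel₀ hlam
  linear_combination lam * h1 - 2 * Real.pi * h2

theorem stripExt_add_sub_pi (hm : AEStronglyMeasurable G)
    (hG : Integrable fun v => ‖G v‖ * Real.exp (-|v| / 2)) (hlam : lam ≠ 0)
    (heq : ∀ u : ℝ, G u = lam * ∫ v, G v * (sechKer (u - v) : ℂ)) {w : ℂ}
    (hw : |w.im| < Real.pi / 2) :
    stripExt G (w + Real.pi * Complex.I) + stripExt G (w - Real.pi * Complex.I) =
      2 * Real.pi * lam * stripExt G w := by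
  have hpi := Real.pi_pos
  set U : Set ℂ := Complex.im ⁻¹' Ioo (-(Real.pi / 2)) (Real.pi / 2) with hU
  have hUo : IsOpen U := isOpen_Ioo.preimage Complex.continuous_im
  have hUc : Convex ℝ U := (convex_Ioo _ _).linear_preimage Complex.imLm
  have hd : ∀ z : ℂ, |z.im| < 3 / 2 * Real.pi → DifferentiableAt ℂ (stripExt G) z :=
    fun z hz => differentiableAt_stripExt hm hG hz
  have hd1 : DifferentiableOn ℂ (fun w => stripExt G (w + Real.pi * Complex.I) +
      stripExt G (w - Real.pi * Complex.I)) U := by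
    intro z hz
    apply DifferentiableAt.differentiableWithinAt
    apply DifferentiableAt.add
    · refine DifferentiableAt.comp (g := stripExt G) (f := fun w => w + Real.pi * Complex.I) z
        (hd _ ?_) (by fun_prop)
      simp only [Complex.add_im, Complex.mul_im, Complex.ofReal_re, Complex.ofReal_im,
        Complex.I_re, Complex.I_im, abs_lt]
      constructor <;> linarith [hz.1, hz.2]
    · refine DifferentiableAt.comp (g := stripExt G) (f := fun w => w - Real.pi * Complex.I) z
        (hd _ ?_) (by fun_prop)
      simp only [Complex.sub_im, Complex.mul_im, Complex.ofReal_re, Complex.ofReal_im,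
        Complex.I_re, Complex.I_im, abs_lt]
      constructor <;> linarith [hz.1, hz.2]
  have hd2 : DifferentiableOn ℂ (fun w => 2 * Real.pi * lam * stripExt G w) U := by
    intro z hz
    apply DifferentiableAt.differentiableWithinAt
    refine (hd z ?_).const_mul _
    rw [abs_lt]
    constructor <;> linarith [hz.1, hz.2]
  refine AnalyticOnNhd.eqOn_of_preconnected_of_frequently_eq (𝕜 := ℂ) (z₀ := 0)
    (hd1.analyticOnNhd hUo) (hd2.analyticOnNhd hUo) hUc.isPreconnected ?_ ?_ (abs_lt.1 hw)
  · simp [hU, hpi]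
  · have hseq : Filter.Tendsto (fun n : ℕ => ((1 / ((n : ℝ) + 1) : ℝ) : ℂ)) Filter.atTop
        (nhdsWithin 0 {0}ᶜ) := by
      rw [tendsto_nhdsWithin_iff]
      constructor
      · have h := (Complex.continuous_ofReal.tendsto 0).comp
          (tendsto_one_div_add_atTop_nhds_zero_nat (𝕜 := ℝ))
        simpa [Function.comp_def] using h
      · refine Filter.Eventually.of_forall fun n => ?_
        simp only [mem_compl_iff, mem_singleton_iff, Complex.ofReal_eq_zero]
        positivity
    refine hseq.frequently (Filter.Eventually.of_forall fun n => ?_).frequently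
    exact stripExt_add_sub_pi_real hm hG hlam heq _

theorem exists_const_stripExt_shift (hm : AEStronglyMeasurable G)
    (hG : Integrable fun v => ‖G v‖ * Real.exp (-|v| / 2)) (hlam : lam ≠ 0)
    (heq : ∀ u : ℝ, G u = lam * ∫ v, G v * (sechKer (u - v) : ℂ)) {γ : ℂ} (hγ : |γ.re| < 1 / 2)
    (hγlam : Real.pi * lam = Complex.cos (Real.pi * γ)) :
    ∃ c, ∀ u : ℝ, stripExt G (u + Real.pi * Complex.I) -
      Complex.exp (-(γ * Real.pi * Complex.I)) * stripExt G u =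
        c * Complex.exp (γ * u) := by
  have hpi := Real.pi_pos
  set p := Complex.exp (γ * Real.pi * Complex.I) with hp
  have hp0 : p ≠ 0 := Complex.exp_ne_zero _
  have hpinv : Complex.exp (-(γ * Real.pi * Complex.I)) = p⁻¹ := Complex.exp_neg _
  have hsum : 2 * Real.pi * lam = p + p⁻¹ := by
    rw [mul_assoc, hγlam, Complex.two_cos, ← hpinv, hp]
    ring_nf
  set h := Complex.exp (γ * (Real.pi / 2 * Complex.I)) with hh
  have hh0 : h ≠ 0 := Complex.exp_ne_zero _
  have hhp : h ^ 2 = p := by rw [hh, hp, ← Complex.exp_nat_mul]; push_cast; ring_nf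
  obtain ⟨C, hC0, hC⟩ := exists_norm_stripExt_le hG
  have him1 : ∀ w : ℂ, (w + Real.pi / 2 * Complex.I).im = w.im + Real.pi / 2 := by
    intro w; simp
  have him2 : ∀ w : ℂ, (w - Real.pi / 2 * Complex.I).im = w.im - Real.pi / 2 := by
    intro w; simp
  have hre1 : ∀ w : ℂ, (w + Real.pi / 2 * Complex.I).re = w.re := by
    intro w; simp
  have hre2 : ∀ w : ℂ, (w - Real.pi / 2 * Complex.I).re = w.re := by
    intro w; simp
  obtain ⟨c, hc⟩ := periodic_strip_const
    (M := fun w => Complex.exp (-(γ * w)) * (stripExt G (w + Real.pi / 2 * Complex.I) -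
      p⁻¹ * stripExt G (w - Real.pi / 2 * Complex.I)))
    (C := Real.exp (|γ.im| * (Real.pi / 2)) * (C + ‖p⁻¹‖ * C)) (a := |γ.re| + 1 / 2)
    (by positivity) (by linarith)
    (by
      intro w hw
      have hw' := abs_lt.1 hw
      have d1 : DifferentiableAt ℂ (fun w => stripExt G (w + Real.pi / 2 * Complex.I)) w := by
        refine DifferentiableAt.comp (g := stripExt G)
          (f := fun w => w + Real.pi / 2 * Complex.I) w
          (differentiableAt_stripExt hm hG ?_) (by fun_prop)
        rw [him1, abs_lt]
        constructor <;> linarith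
      have d2 : DifferentiableAt ℂ (fun w => stripExt G (w - Real.pi / 2 * Complex.I)) w := by
        refine DifferentiableAt.comp (g := stripExt G)
          (f := fun w => w - Real.pi / 2 * Complex.I) w
          (differentiableAt_stripExt hm hG ?_) (by fun_prop)
        rw [him2, abs_lt]
        constructor <;> linarith
      fun_prop)
    (by
      intro w hw
      have hf := stripExt_add_sub_pi hm hG hlam heq hw
      rw [hsum] at hf
      have e1 : w + Real.pi / 2 * Complex.I + Real.pi / 2 * Complex.I = w + Real.pi * Complex.I := by
        ring
      have e2 : w - Real.pi / 2 * Complex.I - Real.pi / 2 * Complex.I = w - Real.pi * Complex.I := by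
        ring
      have e3 : w + Real.pi / 2 * Complex.I - Real.pi / 2 * Complex.I = w := by ring
      have e4 : w - Real.pi / 2 * Complex.I + Real.pi / 2 * Complex.I = w := by ring
      have x1 : Complex.exp (-(γ * (w + Real.pi / 2 * Complex.I))) =
          Complex.exp (-(γ * w)) * h⁻¹ := by
        rw [hh, ← Complex.exp_neg, ← Complex.exp_add]; ring_nf
      have x2 : Complex.exp (-(γ * (w - Real.pi / 2 * Complex.I))) =
          Complex.exp (-(γ * w)) * h := by
        rw [hh, ← Complex.exp_add]; ring_nf
      simp only [e1, e2, e3, e4, x1, x2]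
      rw [← hhp] at hf ⊢
      have hf' : stripExt G (w + Real.pi * Complex.I) =
        (h ^ 2 + (h ^ 2)⁻¹) * stripExt G w - stripExt G (w - Real.pi * Complex.I) := by
        linear_combination hf
      rw [hf']
      field_simp
      ring)
    (by
      intro w hw
      have hw' := abs_le.1 hw
      have b1 := hC (w + Real.pi / 2 * Complex.I) (by
        rw [him1, abs_le]; constructor <;> linarith)
      have b2 := hC (w - Real.pi / 2 * Complex.I) (by
        rw [him2, abs_le]; constructor <;> linarith)
      rw [hre1] at b1
      rw [hre2] at b2
      have b3 : ‖Complex.exp (-(γ * w))‖ ≤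
          Real.exp (|γ.im| * (Real.pi / 2)) * Real.exp (|γ.re| * |w.re|) := by
        rw [Complex.norm_exp, ← Real.exp_add, Real.exp_le_exp, Complex.neg_re, Complex.mul_re]
        have a1 : -(γ.re * w.re) ≤ |γ.re| * |w.re| := by
          rw [← abs_mul]; exact neg_le_abs _
        have a2 : γ.im * w.im ≤ |γ.im| * (Real.pi / 2) := by
          calc _ ≤ |γ.im * w.im| := le_abs_self _
            _ = |γ.im| * |w.im| := abs_mul _ _
            _ ≤ _ := by gcongr
        linarith
      have b4 : ‖stripExt G (w + Real.pi / 2 * Complex.I) -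
          p⁻¹ * stripExt G (w - Real.pi / 2 * Complex.I)‖ ≤
          (C + ‖p⁻¹‖ * C) * Real.exp (|w.re| / 2) := by
        refine (norm_sub_le _ _).trans ?_
        rw [norm_mul]
        have := mul_le_mul_of_nonneg_left b2 (norm_nonneg p⁻¹)
        linarith
      rw [norm_mul]
      calc _ ≤ (Real.exp (|γ.im| * (Real.pi / 2)) * Real.exp (|γ.re| * |w.re|)) *
            ((C + ‖p⁻¹‖ * C) * Real.exp (|w.re| / 2)) := by gcongr
        _ = Real.exp (|γ.im| * (Real.pi / 2)) * (C + ‖p⁻¹‖ * C) *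
            (Real.exp (|γ.re| * |w.re|) * Real.exp (|w.re| / 2)) := by ring
        _ = _ := by rw [← Real.exp_add]; ring_nf)
  refine ⟨c * h, fun u => ?_⟩
  have h1 := hc u
  have e1 : (u : ℂ) + Real.pi / 2 * Complex.I + Real.pi / 2 * Complex.I = u + Real.pi * Complex.I := by
    ring
  have e3 : (u : ℂ) + Real.pi / 2 * Complex.I - Real.pi / 2 * Complex.I = u := by ring
  have x1 : Complex.exp (-(γ * (u + Real.pi / 2 * Complex.I))) =
      (Complex.exp (γ * u))⁻¹ * h⁻¹ := by
    rw [hh, ← Complex.exp_neg, ← Complex.exp_neg, ← Complex.exp_add]; ring_nf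
  simp only [e1, e3, x1] at h1
  rw [hpinv, ← h1]
  have := Complex.exp_ne_zero (γ * u)
  field_simp

theorem exists_stripExt_eq_exp (hm : AEStronglyMeasurable G)
    (hG : Integrable fun v => ‖G v‖ * Real.exp (-|v| / 2)) (hlam : lam ≠ 0)
    (heq : ∀ u : ℝ, G u = lam * ∫ v, G v * (sechKer (u - v) : ℂ)) {γ : ℂ} (hγ : |γ.re| < 1 / 2)
    (hγ0 : γ ≠ 0) (hγlam : Real.pi * lam = Complex.cos (Real.pi * γ)) :
    ∃ A B : ℂ, ∀ u : ℝ, stripExt G u = A * Complex.exp (γ * u) + B * Complex.exp (-γ * u) := by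
  obtain ⟨c, hc⟩ := exists_const_stripExt_shift hm hG hlam heq hγ hγlam
  obtain ⟨d, hd⟩ := exists_const_stripExt_shift hm hG hlam heq (γ := -γ) (by simpa using hγ)
    (by rw [hγlam, mul_neg, Complex.cos_neg])
  set s := Complex.exp (γ * Real.pi * Complex.I) - Complex.exp (-(γ * Real.pi * Complex.I)) with hs
  have hs0 : s ≠ 0 := by
    intro h
    have h1 : Complex.exp (γ * Real.pi * Complex.I) = Complex.exp (-(γ * Real.pi * Complex.I)) :=
      sub_eq_zero.1 h
    obtain ⟨n, hn⟩ := Complex.exp_eq_exp_iff_exists_int.1 h1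
    have hpI : (2 * Real.pi * Complex.I : ℂ) ≠ 0 := Complex.two_pi_I_ne_zero
    have hγn : γ = n := by
      apply mul_right_cancel₀ hpI
      linear_combination hn
    have hn0 : n = 0 := by
      by_contra hn0
      have : (1 : ℝ) ≤ |(n : ℝ)| := by exact_mod_cast Int.one_le_abs hn0
      rw [hγn, Complex.intCast_re] at hγ
      linarith
    exact hγ0 (by rw [hγn, hn0]; simp)
  refine ⟨c / s, -d / s, fun u => ?_⟩
  have h1 := hc u
  have h2 := hd u
  rw [show -(-γ * Real.pi * Complex.I) = γ * Real.pi * Complex.I by ring] at h2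
  field_simp
  rw [hs]
  ring_nf at h1 h2 ⊢
  linear_combination h1 - h2

theorem tendsto_mul_exp_neg_half (hm : AEStronglyMeasurable G)
    (hG : Integrable fun v => ‖G v‖ * Real.exp (-|v| / 2))
    (heq : ∀ u : ℝ, G u = lam * ∫ v, G v * (sechKer (u - v) : ℂ)) {l : Filter ℝ}
    [l.IsCountablyGenerated] (hl : Filter.Tendsto (fun u : ℝ => |u|) l Filter.atTop) :
    Filter.Tendsto (fun u : ℝ => (Real.exp (-|u| / 2) : ℂ) * G u) l (nhds 0) := by
  have c1 := continuous_sechKer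
  have hl2 : Filter.Tendsto (fun u : ℝ => Real.exp (-|u| / 2)) l (nhds 0) := by
    refine Real.tendsto_exp_atBot.comp ?_
    simp_rw [neg_div]
    exact Filter.tendsto_neg_atTop_atBot.comp (hl.atTop_div_const (by norm_num))
  have hlim : Filter.Tendsto
      (fun u : ℝ => ∫ v, (Real.exp (-|u| / 2) : ℂ) * (G v * (sechKer (u - v) : ℂ))) l
      (nhds (∫ _ : ℝ, (0 : ℂ))) := by
    refine tendsto_integral_filter_of_dominated_convergence
      (fun v => ‖G v‖ * Real.exp (-|v| / 2)) ?_ ?_ hG ?_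
    · exact Filter.Eventually.of_forall fun u =>
        aestronglyMeasurable_const.mul (hm.mul (by fun_prop))
    · refine Filter.Eventually.of_forall fun u => Filter.Eventually.of_forall fun v => ?_
      rw [norm_mul, norm_mul, Complex.norm_real, Complex.norm_real,
        Real.norm_of_nonneg (sechKer_pos _).le, Real.norm_of_nonneg (Real.exp_pos _).le]
      have h1 : Real.exp (-|u| / 2) * sechKer (u - v) ≤ Real.exp (-|v| / 2) := by
        have := exp_neg_abs_sub_le u v
        calc _ ≤ Real.exp (-|u| / 2) * (Real.exp (|u| / 2) * Real.exp (-|v| / 2)) := by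
              gcongr; exact (sechKer_le _).trans this
          _ = _ := by rw [← Real.exp_add, ← Real.exp_add]; ring_nf
      calc _ = ‖G v‖ * (Real.exp (-|u| / 2) * sechKer (u - v)) := by ring
        _ ≤ _ := by gcongr
    · refine Filter.Eventually.of_forall fun v => ?_
      refine squeeze_zero_norm (a := fun u => Real.exp (-|u| / 2) * ‖G v‖) (fun u => ?_) ?_
      · rw [norm_mul, norm_mul, Complex.norm_real, Complex.norm_real,
          Real.norm_of_nonneg (sechKer_pos _).le, Real.norm_of_nonneg (Real.exp_pos _).le]
        have h2 : sechKer (u - v) ≤ 1 := (sechKer_le _).trans (by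
          rw [Real.exp_le_one_iff]; linarith [abs_nonneg (u - v)])
        gcongr
        exact mul_le_of_le_one_right (norm_nonneg _) h2
      · simpa using hl2.mul_const ‖G v‖
  rw [integral_zero] at hlim
  have := hlim.const_mul lam
  rw [mul_zero] at this
  refine this.congr fun u => ?_
  rw [integral_const_mul, heq u]
  ring

end StripExt

/-- A periodic function tending to zero along one end of the line vanishes. -/
theorem eq_zero_of_periodic_of_tendsto {k : ℝ → ℂ} {c : ℝ} {l : Filter ℝ}
    (hper : Function.Periodic k c)
    (hl : ∀ u : ℝ, Filter.Tendsto (fun n : ℕ => u + n * c) Filter.atTop l)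
    (hk : Filter.Tendsto k l (nhds 0)) (u : ℝ) : k u = 0 := by
  have h := hk.comp (hl u)
  have h2 : (k ∘ fun n : ℕ => u + n * c) = fun _ => k u := by
    ext n; exact (hper.nat_mul n) u
  rw [h2] at h
  exact tendsto_nhds_unique tendsto_const_nhds h

theorem eq_zero_of_secondDiff_eq_zero {h : ℝ → ℂ} (hz : ∀ u, secondDiff h u = 0)
    (htop : Filter.Tendsto (fun u : ℝ => (Real.exp (-|u| / 2) : ℂ) * h u) Filter.atTop (nhds 0))
    (hbot : Filter.Tendsto (fun u : ℝ => (Real.exp (-|u| / 2) : ℂ) * h u) Filter.atBot (nhds 0))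
    (u : ℝ) : h u = 0 := by
  set E : ℂ := Complex.exp 1 with hE
  have hE0 : E ≠ 0 := Complex.exp_ne_zero _
  have hcosh : 2 * (Real.cosh 1 : ℂ) = E + E⁻¹ := by
    rw [Complex.ofReal_cosh, Complex.ofReal_one, Complex.two_cosh, hE, Complex.exp_neg]
  have hz' : ∀ u, h (u + 2) = (E + E⁻¹) * h u - h (u - 2) := by
    intro u
    have := hz u
    unfold secondDiff at this
    rw [hcosh] at this
    linear_combination this
  have ht : Filter.Tendsto (fun u : ℝ => Complex.exp (-u / 2) * h u) Filter.atTop (nhds 0) := by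
    refine htop.congr' ?_
    filter_upwards [Filter.eventually_ge_atTop 0] with u hu
    rw [abs_of_nonneg hu]; push_cast; rfl
  have hb : Filter.Tendsto (fun u : ℝ => Complex.exp (u / 2) * h u) Filter.atBot (nhds 0) := by
    refine hbot.congr' ?_
    filter_upwards [Filter.eventually_le_atBot 0] with u hu
    rw [abs_of_nonpos hu, neg_neg]; push_cast; rfl
  have s1 : ∀ u : ℝ, Complex.exp (-((u + 2 : ℝ) : ℂ) / 2) = Complex.exp (-u / 2) * E⁻¹ := by
    intro u
    rw [hE, ← Complex.exp_neg, ← Complex.exp_add]; push_cast; ring_nf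
  have s2 : ∀ u : ℝ, Complex.exp (-((u - 2 : ℝ) : ℂ) / 2) = Complex.exp (-u / 2) * E := by
    intro u
    rw [hE, ← Complex.exp_add]; push_cast; ring_nf
  have s3 : ∀ u : ℝ, Complex.exp (((u - 2 : ℝ) : ℂ) / 2) = Complex.exp (u / 2) * E⁻¹ := by
    intro u
    rw [hE, ← Complex.exp_neg, ← Complex.exp_add]; push_cast; ring_nf
  have hfirst : ∀ u : ℝ, Complex.exp (-(u : ℂ) / 2) * (h u - E⁻¹ * h (u - 2)) = 0 := by
    intro u
    refine eq_zero_of_periodic_of_tendsto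
      (k := fun u : ℝ => Complex.exp (-u / 2) * (h u - E⁻¹ * h (u - 2))) (c := 2)
      (l := Filter.atTop) ?_ ?_ ?_ u
    · intro u
      simp only [s1]
      rw [add_sub_cancel_right, hz']
      field_simp
      ring
    · intro u
      exact Filter.tendsto_atTop_add_const_left _ _
        (tendsto_natCast_atTop_atTop.atTop_mul_const (by norm_num))
    · have hsh := ht.comp (Filter.tendsto_atTop_add_const_right _ (-2 : ℝ) Filter.tendsto_id)
      have := ht.sub (hsh.const_mul (E⁻¹ * E⁻¹))
      simp only [mul_zero, sub_zero] at this
      refine this.congr fun u => ?_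
      simp only [Function.comp, id, ← sub_eq_add_neg, s2]
      field_simp
  have hsecond := eq_zero_of_periodic_of_tendsto
      (k := fun u : ℝ => Complex.exp (u / 2) * h u) (c := -2)
      (l := Filter.atBot) ?_ ?_ hb u
  · exact (mul_eq_zero.1 hsecond).resolve_left (Complex.exp_ne_zero _)
  · intro u
    have := (mul_eq_zero.1 (hfirst u)).resolve_left (Complex.exp_ne_zero _)
    simp only [← sub_eq_add_neg, s3]
    linear_combination -Complex.exp (u / 2) * this
  · intro u
    exact Filter.tendsto_atBot_add_const_left _ _
      (tendsto_natCast_atTop_atTop.atTop_mul_const_of_neg (by norm_num))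

theorem secondDiff_exp (c γ : ℂ) (u : ℝ) :
    secondDiff (fun u => c * Complex.exp (γ * u)) u =
      (2 * Complex.cosh (2 * γ) - 2 * Real.cosh 1) * (c * Complex.exp (γ * u)) := by
  have e1 : Complex.exp (γ * ((u + 2 : ℝ) : ℂ)) =
      Complex.exp (2 * γ) * Complex.exp (γ * u) := by
    rw [← Complex.exp_add]; push_cast; ring_nf
  have e2 : Complex.exp (γ * ((u - 2 : ℝ) : ℂ)) =
      Complex.exp (-(2 * γ)) * Complex.exp (γ * u) := by
    rw [← Complex.exp_add]; push_cast; ring_nf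
  simp only [secondDiff]
  rw [e1, e2, Complex.two_cosh]
  ring

theorem norm_cosh_le_cosh_re (z : ℂ) : ‖Complex.cosh z‖ ≤ Real.cosh z.re := by
  have h1 : ‖Complex.exp z + Complex.exp (-z)‖ = 2 * ‖Complex.cosh z‖ := by
    rw [← Complex.two_cosh, norm_mul]; simp
  have h2 := norm_add_le (Complex.exp z) (Complex.exp (-z))
  rw [h1, Complex.norm_exp, Complex.norm_exp, Complex.neg_re] at h2
  rw [Real.cosh_eq]
  linarith

theorem tendsto_exp_neg_half_mul_exp {γ : ℂ} (hγ : |γ.re| < 1 / 2) (c : ℂ) {l : Filter ℝ}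
    (hl : Filter.Tendsto (fun u : ℝ => |u|) l Filter.atTop) :
    Filter.Tendsto (fun u : ℝ => (Real.exp (-|u| / 2) : ℂ) * (c * Complex.exp (γ * u))) l
      (nhds 0) := by
  have h1 : Filter.Tendsto (fun u : ℝ => ‖c‖ * Real.exp ((|γ.re| - 1 / 2) * |u|)) l (nhds 0) := by
    rw [← mul_zero ‖c‖]
    exact (Real.tendsto_exp_atBot.comp
      (hl.const_mul_atTop_of_neg (by linarith))).const_mul _
  refine squeeze_zero_norm (fun u => ?_) h1
  rw [norm_mul, norm_mul, Complex.norm_real, Real.norm_of_nonneg (Real.exp_pos _).le,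
    Complex.norm_exp]
  have h2 : (γ * (u : ℂ)).re ≤ |γ.re| * |u| := by
    rw [Complex.re_mul_ofReal, ← abs_mul]; exact le_abs_self _
  calc Real.exp (-|u| / 2) * (‖c‖ * Real.exp (γ * (u : ℂ)).re)
      ≤ Real.exp (-|u| / 2) * (‖c‖ * Real.exp (|γ.re| * |u|)) := by gcongr
    _ = ‖c‖ * (Real.exp (-|u| / 2) * Real.exp (|γ.re| * |u|)) := by ring
    _ = _ := by rw [← Real.exp_add]; ring_nf

/-- Solutions of the convolution equation with kernel `sechKer` are combinations of two
exponentials. -/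
theorem exists_eq_exp_of_eq_convolution {G : ℝ → ℂ} {lam : ℂ} (hm : AEStronglyMeasurable G)
    (hG : Integrable fun v => ‖G v‖ * Real.exp (-|v| / 2)) (hlam : lam ≠ 0)
    (heq : ∀ u : ℝ, G u = lam * ∫ v, G v * (sechKer (u - v) : ℂ)) {γ : ℂ} (hγ : |γ.re| < 1 / 2)
    (hγ0 : γ ≠ 0) (hγlam : Real.pi * lam = Complex.cos (Real.pi * γ)) :
    ∃ A B : ℂ, ∀ u : ℝ, G u = A * Complex.exp (γ * u) + B * Complex.exp (-γ * u) := by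
  obtain ⟨A, B, hAB⟩ := exists_stripExt_eq_exp hm hG hlam heq hγ hγ0 hγlam
  set d : ℂ := 2 * Complex.cosh (2 * γ) - 2 * Real.cosh 1 with hd
  have hd0 : d ≠ 0 := by
    intro h
    have h1 : Complex.cosh (2 * γ) = (Real.cosh 1 : ℂ) := by
      apply mul_left_cancel₀ (two_ne_zero (α := ℂ)); exact sub_eq_zero.1 h
    have h2 := norm_cosh_le_cosh_re (2 * γ)
    rw [h1, Complex.norm_real, Real.norm_of_nonneg (Real.cosh_pos _).le, Real.cosh_le_cosh] at h2
    simp [abs_mul] at h2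
    linarith
  have hγ' : |(-γ).re| < 1 / 2 := by simpa using hγ
  have htop := Filter.tendsto_abs_atTop_atTop (G := ℝ)
  have hbot := Filter.tendsto_abs_atBot_atTop (G := ℝ)
  refine ⟨lam ^ 2 * A / d, lam ^ 2 * B / d, fun u => ?_⟩
  set h : ℝ → ℂ := fun u => G u - (lam ^ 2 * A / d * Complex.exp (γ * u) +
    lam ^ 2 * B / d * Complex.exp (-γ * u)) with hh
  have hlim : ∀ {l : Filter ℝ} [l.IsCountablyGenerated],
      Filter.Tendsto (fun u : ℝ => |u|) l Filter.atTop →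
      Filter.Tendsto (fun u : ℝ => (Real.exp (-|u| / 2) : ℂ) * h u) l (nhds 0) := by
    intro l _ hl
    have := (tendsto_mul_exp_neg_half hm hG heq hl).sub
      ((tendsto_exp_neg_half_mul_exp hγ (lam ^ 2 * A / d) hl).add
        (tendsto_exp_neg_half_mul_exp hγ' (lam ^ 2 * B / d) hl))
    simp only [add_zero, sub_zero] at this
    refine this.congr fun u => ?_
    simp only [hh]
    ring
  refine sub_eq_zero.1 (eq_zero_of_secondDiff_eq_zero (h := h) (fun u => ?_)
    (hlim htop) (hlim hbot) u)
  have h1 : secondDiff h u = secondDiff G u -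
      (secondDiff (fun u => lam ^ 2 * A / d * Complex.exp (γ * u)) u +
        secondDiff (fun u => lam ^ 2 * B / d * Complex.exp (-γ * u)) u) := by
    simp only [hh, secondDiff]; ring
  rw [h1, secondDiff_exp, secondDiff_exp, mul_neg, Complex.cosh_neg, ← hd,
    secondDiff_eq_stripExt hm hG heq, hAB]
  field_simp
  ring

theorem exp_neg_abs_le_two_mul_sechKer (t : ℝ) : Real.exp (-|t| / 2) ≤ 2 * sechKer t := by
  unfold sechKer
  have h1 : Real.cosh (t / 2) ≤ Real.exp |t / 2| := by
    rw [← Real.cosh_abs, Real.cosh_eq]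
    have : Real.exp (-|t / 2|) ≤ Real.exp |t / 2| := by
      rw [Real.exp_le_exp]; linarith [abs_nonneg (t / 2)]
    linarith
  rw [abs_div, abs_two] at h1
  have h2 := Real.cosh_pos (t / 2)
  rw [neg_div, Real.exp_neg]
  calc (Real.exp (|t| / 2))⁻¹ ≤ (Real.cosh (t / 2))⁻¹ := inv_anti₀ h2 h1
    _ = _ := by field_simp

theorem integrable_exp_mul_sechKer {γ : ℂ} (hγ : |γ.re| < 1 / 2) (u : ℝ) :
    Integrable fun v : ℝ => Complex.exp (γ * v) * (sechKer (u - v) : ℂ) := by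
  have hc := continuous_sechKer
  refine integrable_mul_sechKer (by fun_prop) ?_ u
  refine (integrable_exp_neg_mul_abs (a := 1 / 2 - |γ.re|) (by linarith)).mono'
    (by fun_prop) (Filter.Eventually.of_forall fun v => ?_)
  rw [norm_mul, norm_norm, Complex.norm_exp, Real.norm_of_nonneg (Real.exp_pos _).le,
    ← Real.exp_add, Real.exp_le_exp, Complex.re_mul_ofReal]
  have : γ.re * v ≤ |γ.re| * |v| := by rw [← abs_mul]; exact le_abs_self _
  linarith

theorem betaIntegral_one_sub {s : ℂ} (h0 : 0 < s.re) (h1 : s.re < 1) :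
    Complex.betaIntegral s (1 - s) = Real.pi / Complex.sin (Real.pi * s) := by
  have := Complex.Gamma_mul_Gamma_eq_betaIntegral (s := s) (t := 1 - s) h0 (by simpa using h1)
  rw [Complex.Gamma_mul_Gamma_one_sub, add_sub_cancel, Complex.Gamma_one, one_mul] at this
  exact this.symm

theorem integral_exp_mul_sechKer {γ : ℂ} (hγ : |γ.re| < 1 / 2) :
    ∫ v : ℝ, Complex.exp (γ * v) * (sechKer v : ℂ) = Real.pi / Complex.cos (Real.pi * γ) := by
  have hγ' := abs_lt.1 hγ
  set s : ℂ := 1 / 2 + γ with hs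
  have hsre : s.re = 1 / 2 + γ.re := by simp [hs]
  have hb := betaIntegral_one_sub (s := s) (by rw [hsre]; linarith) (by rw [hsre]; linarith)
  rw [show (Real.pi : ℂ) * s = Real.pi * γ + Real.pi / 2 by rw [hs]; ring,
    Complex.sin_add_pi_div_two, Complex.betaIntegral, intervalIntegral.integral_of_le zero_le_one,
    integral_Ioc_eq_integral_Ioo, ← Real.range_sigmoid, ← image_univ,
    integral_image_eq_integral_abs_deriv_smul MeasurableSet.univ
      (fun x _ => (Real.hasDerivAt_sigmoid x).hasDerivWithinAt)
      Real.sigmoid_injective.injOn, setIntegral_univ] at hb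
  rw [← hb]
  refine integral_congr_ae (Filter.Eventually.of_forall fun t => ?_)
  have p0 := Real.sigmoid_pos t
  have p1 := Real.sigmoid_pos (-t)
  have hsum : 1 - Real.sigmoid t = Real.sigmoid (-t) := (Real.sigmoid_neg t).symm
  have hcosh : 1 + Real.exp (-t) = Real.exp (-(t / 2)) * (2 * Real.cosh (t / 2)) := by
    rw [Real.cosh_eq]
    have e1 : Real.exp (-(t / 2)) * Real.exp (t / 2) = 1 := by rw [← Real.exp_add]; simp
    have e2 : Real.exp (-(t / 2)) * Real.exp (-(t / 2)) = Real.exp (-t) := by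
      rw [← Real.exp_add]; ring_nf
    rw [← e2]; linear_combination -e1
  have hsig : Real.sigmoid t = Real.exp (t / 2) * sechKer t := by
    have hc := Real.cosh_pos (t / 2)
    rw [Real.sigmoid_def, hcosh, sechKer, mul_inv, ← Real.exp_neg, neg_neg, one_div]
  have hratio : Real.sigmoid (-t) = Real.sigmoid t * Real.exp (-t) :=
    (Real.sigmoid_mul_rexp_neg t).symm
  have hx : ∀ {x : ℝ}, 0 < x → ∀ z : ℂ, (x : ℂ) * (x : ℂ) ^ (z - 1) = (x : ℂ) ^ z := by
    intro x hx z
    have hx0 : (x : ℂ) ≠ 0 := by exact_mod_cast hx.ne'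
    rw [Complex.cpow_sub _ _ hx0, Complex.cpow_one]
    field_simp
  have h1 : (1 : ℂ) - (Real.sigmoid t : ℂ) = (Real.sigmoid (-t) : ℂ) := by
    rw [← hsum]; push_cast; rfl
  have hS0 : (Real.sigmoid t : ℂ) ≠ 0 := by exact_mod_cast p0.ne'
  have hexp : ((Real.exp (-t) : ℝ) : ℂ) ^ (1 - s) = Complex.exp (-t * (1 - s)) := by
    rw [Complex.ofReal_exp, Complex.cpow_def_of_ne_zero (Complex.exp_ne_zero _),
      ← Complex.ofReal_exp, ← Complex.ofReal_log (Real.exp_pos _).le, Real.log_exp]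
    push_cast; rfl
  beta_reduce
  rw [hsum, abs_of_pos (mul_pos p0 p1), Complex.real_smul, h1]
  push_cast
  calc Complex.exp (γ * t) * (sechKer t : ℂ)
      = Complex.exp (-t * (1 - s)) * (Complex.exp (t / 2) * (sechKer t : ℂ)) := by
        rw [← mul_assoc, ← Complex.exp_add, hs]; ring_nf
    _ = Complex.exp (-t * (1 - s)) * (Real.sigmoid t : ℂ) := by rw [hsig]; push_cast; rfl
    _ = (Real.sigmoid t : ℂ) ^ s * ((Real.sigmoid t : ℂ) ^ (1 - s) *
          Complex.exp (-t * (1 - s))) := by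
        have : (Real.sigmoid t : ℂ) ^ s * (Real.sigmoid t : ℂ) ^ (1 - s) = Real.sigmoid t := by
          rw [← Complex.cpow_add _ _ hS0, add_sub_cancel, Complex.cpow_one]
        linear_combination -Complex.exp (-t * (1 - s)) * this
    _ = (Real.sigmoid t : ℂ) ^ s * (Real.sigmoid (-t) : ℂ) ^ (1 - s) := by
        rw [hratio, Complex.ofReal_mul,
          Complex.mul_cpow_ofReal_nonneg p0.le (Real.exp_pos _).le, hexp]
    _ = _ := by
        rw [← hx p0 s, ← hx p1 (1 - s)]; ring

theorem integral_exp_mul_sechKer_sub {γ : ℂ} (hγ : |γ.re| < 1 / 2) (u : ℝ) :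
    ∫ v : ℝ, Complex.exp (γ * v) * (sechKer (u - v) : ℂ) =
      Real.pi / Complex.cos (Real.pi * γ) * Complex.exp (γ * u) := by
  have h := integral_exp_mul_sechKer (γ := -γ) (by simpa using hγ)
  rw [mul_neg, Complex.cos_neg] at h
  rw [← integral_sub_left_eq_self _ _ u, ← h, ← integral_mul_const]
  refine integral_congr_ae (Filter.Eventually.of_forall fun v => ?_)
  have e : Complex.exp (γ * ((u - v : ℝ) : ℂ)) =
      Complex.exp (-γ * v) * Complex.exp (γ * u) := by
    rw [← Complex.exp_add]; push_cast; ring_nf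
  simp only [e, sub_sub_cancel]
  ring

/-- Passing to logarithmic coordinates with the weight `exp (v / 2)`. -/
def logTransform (f : ℝ → ℂ) (v : ℝ) : ℂ := (Real.exp (v / 2) : ℂ) * f (Real.exp v)

theorem exp_smul_div_add_exp (f : ℝ → ℂ) (u v : ℝ) :
    |Real.exp v| • (f (Real.exp v) / ((Real.exp u : ℂ) + (Real.exp v : ℂ))) =
      (Real.exp (-(u / 2)) : ℂ) * (logTransform f v * (sechKer (u - v) : ℂ)) := by
  have h : Real.exp v * (Real.exp u + Real.exp v)⁻¹ =
      Real.exp (-(u / 2)) * (Real.exp (v / 2) * sechKer (u - v)) := by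
    have hs : Real.exp u + Real.exp v =
        Real.exp (u / 2) * Real.exp (v / 2) * (2 * Real.cosh ((u - v) / 2)) := by
      have e1 : Real.exp (u / 2) * Real.exp (v / 2) * Real.exp ((u - v) / 2) = Real.exp u := by
        rw [← Real.exp_add, ← Real.exp_add]; ring_nf
      have e2 : Real.exp (u / 2) * Real.exp (v / 2) * Real.exp (-((u - v) / 2)) = Real.exp v := by
        rw [← Real.exp_add, ← Real.exp_add]; ring_nf
      rw [Real.cosh_eq]
      linear_combination -e1 - e2
    have hv : Real.exp v = Real.exp (v / 2) * Real.exp (v / 2) := by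
      rw [← Real.exp_add]; ring_nf
    rw [hs, hv, sechKer, Real.exp_neg]
    have := Real.cosh_pos ((u - v) / 2)
    field_simp
  have hC := congrArg (fun r : ℝ => (r : ℂ)) h
  simp only [Complex.ofReal_mul, Complex.ofReal_inv, Complex.ofReal_add] at hC
  rw [abs_of_pos (Real.exp_pos v), Complex.real_smul, logTransform, div_eq_mul_inv]
  linear_combination f (Real.exp v) * hC

theorem integrableOn_div_add_iff (f : ℝ → ℂ) (u : ℝ) :
    IntegrableOn (fun y : ℝ => f y / ((Real.exp u : ℂ) + (y : ℂ))) (Ioi 0) ↔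
      Integrable fun v : ℝ => logTransform f v * (sechKer (u - v) : ℂ) := by
  rw [← Real.range_exp, ← image_univ, integrableOn_image_iff_integrableOn_abs_deriv_smul
    MeasurableSet.univ (fun x _ => (Real.hasDerivAt_exp x).hasDerivWithinAt)
    Real.exp_injective.injOn, integrableOn_univ]
  simp_rw [exp_smul_div_add_exp]
  exact integrable_const_mul_iff
    (isUnit_iff_ne_zero.2 (Complex.ofReal_ne_zero.2 (Real.exp_ne_zero _))) _

theorem integral_div_add (f : ℝ → ℂ) (u : ℝ) :
    ∫ y in Ioi (0 : ℝ), f y / ((Real.exp u : ℂ) + (y : ℂ)) =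
      (Real.exp (-(u / 2)) : ℂ) * ∫ v : ℝ, logTransform f v * (sechKer (u - v) : ℂ) := by
  rw [← Real.range_exp, ← image_univ, integral_image_eq_integral_abs_deriv_smul
    MeasurableSet.univ (fun x _ => (Real.hasDerivAt_exp x).hasDerivWithinAt)
    Real.exp_injective.injOn, setIntegral_univ]
  simp_rw [exp_smul_div_add_exp]
  rw [integral_const_mul]

theorem MemE.integrable_logTransform_mul_sechKer {f : ℝ → ℂ} (hf : MemE f) :
    Integrable fun v : ℝ => logTransform f v * (sechKer v : ℂ) := by
  have h := (integrableOn_div_add_iff f 0).1 (by simpa [MemE] using hf)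
  refine h.congr (Filter.Eventually.of_forall fun v => ?_)
  simp [sechKer, neg_div]

theorem MemE.aestronglyMeasurable_logTransform {f : ℝ → ℂ} (hf : MemE f) :
    AEStronglyMeasurable (logTransform f) := by
  have hne : ∀ v, (sechKer v : ℂ) ≠ 0 := fun v => Complex.ofReal_ne_zero.2 (sechKer_pos v).ne'
  have hc : Continuous fun v => (sechKer v : ℂ)⁻¹ :=
    (Complex.continuous_ofReal.comp continuous_sechKer).inv₀ hne
  refine (hf.integrable_logTransform_mul_sechKer.aestronglyMeasurable.mul
    hc.aestronglyMeasurable).congr (Filter.Eventually.of_forall fun v => ?_)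
  have := hne v
  simp [this]

theorem MemE.integrable_norm_logTransform_mul_exp {f : ℝ → ℂ} (hf : MemE f) :
    Integrable fun v => ‖logTransform f v‖ * Real.exp (-|v| / 2) := by
  refine (hf.integrable_logTransform_mul_sechKer.norm.const_mul 2).mono'
    (hf.aestronglyMeasurable_logTransform.norm.mul (by fun_prop))
    (Filter.Eventually.of_forall fun v => ?_)
  rw [norm_mul, norm_norm, norm_mul, Complex.norm_real, Real.norm_of_nonneg (sechKer_pos v).le,
    Real.norm_of_nonneg (Real.exp_pos _).le]
  calc _ ≤ ‖logTransform f v‖ * (2 * sechKer v) := by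
        gcongr; exact exp_neg_abs_le_two_mul_sechKer v
    _ = _ := by ring

theorem exp_cpow (u : ℝ) (z : ℂ) : (Real.exp u : ℂ) ^ z = Complex.exp (z * u) := by
  rw [Complex.cpow_def_of_ne_zero (Complex.ofReal_ne_zero.2 (Real.exp_ne_zero _)),
    ← Complex.ofReal_log (Real.exp_pos _).le, Real.log_exp, mul_comm]

theorem eq_cpow_iff_logTransform_eq (f : ℝ → ℂ) (α A B : ℂ) :
    (∀ x : ℝ, 0 < x → f x = A * (x : ℂ) ^ (-α) + B * (x : ℂ) ^ (α - 1)) ↔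
      ∀ u : ℝ, logTransform f u =
        A * Complex.exp ((1 / 2 - α) * u) + B * Complex.exp (-(1 / 2 - α) * u) := by
  have key : ∀ u : ℝ, A * Complex.exp ((1 / 2 - α) * u) + B * Complex.exp (-(1 / 2 - α) * u) =
      (Real.exp (u / 2) : ℂ) *
        (A * (Real.exp u : ℂ) ^ (-α) + B * (Real.exp u : ℂ) ^ (α - 1)) := by
    intro u
    have e1 : Complex.exp ((1 / 2 - α) * u) = (Real.exp (u / 2) : ℂ) * Complex.exp (-α * u) := by
      rw [Complex.ofReal_exp, ← Complex.exp_add]; push_cast; ring_nf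
    have e2 : Complex.exp (-(1 / 2 - α) * u) =
        (Real.exp (u / 2) : ℂ) * Complex.exp ((α - 1) * u) := by
      rw [Complex.ofReal_exp, ← Complex.exp_add]; push_cast; ring_nf
    rw [exp_cpow, exp_cpow, e1, e2]
    ring
  constructor
  · intro h u
    rw [key, logTransform, h _ (Real.exp_pos u)]
  · intro h x hx
    have := h (Real.log x)
    rw [key, logTransform, Real.exp_log hx] at this
    exact mul_left_cancel₀ (Complex.ofReal_ne_zero.2 (Real.exp_ne_zero _)) this

theorem stieltjes_iff_logTransform {f : ℝ → ℂ} (hf : MemE f) (lam : ℂ) :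
    (∀ x : ℝ, 0 < x →
        IntegrableOn (fun y : ℝ => f y / ((x : ℂ) + (y : ℂ))) (Ioi 0) ∧
        f x = lam * ∫ y in Ioi (0 : ℝ), f y / ((x : ℂ) + (y : ℂ))) ↔
      ∀ u : ℝ, logTransform f u = lam * ∫ v, logTransform f v * (sechKer (u - v) : ℂ) := by
  have hcancel : ∀ u : ℝ, (Real.exp (u / 2) : ℂ) * (Real.exp (-(u / 2)) : ℂ) = 1 := by
    intro u
    rw [← Complex.ofReal_mul, ← Real.exp_add, add_neg_cancel, Real.exp_zero, Complex.ofReal_one]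
  constructor
  · intro h u
    conv_lhs => rw [logTransform, (h _ (Real.exp_pos u)).2, integral_div_add]
    linear_combination (lam * ∫ v, logTransform f v * (sechKer (u - v) : ℂ)) * hcancel u
  · intro h x hx
    obtain ⟨u, rfl⟩ : ∃ u, Real.exp u = x := ⟨_, Real.exp_log hx⟩
    refine ⟨(integrableOn_div_add_iff f u).2 (integrable_mul_sechKer
      hf.aestronglyMeasurable_logTransform hf.integrable_norm_logTransform_mul_exp u), ?_⟩
    have := h u
    rw [logTransform] at this
    rw [integral_div_add]
    linear_combination (Real.exp (-(u / 2)) : ℂ) * this - f (Real.exp u) * hcancel u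

/-- for `0 < Re α ≤ 1/2`, `α ≠ 1/2`, `λ = sin(πα)/π`, a function `f ∈ E`
solves the homogeneous Stieltjes equation iff `f(x) = A·x^{-α} + B·x^{α-1}`. -/
theorem stmt1 (α : ℂ) (hα1 : 0 < α.re) (hα2 : α.re ≤ 1/2) (hα3 : α ≠ 1/2)
    (lam : ℂ) (hlam : lam = Complex.sin ((Real.pi : ℂ) * α) / (Real.pi : ℂ))
    (f : ℝ → ℂ) (hf : MemE f) :
    (∀ x : ℝ, 0 < x →
        IntegrableOn (fun y : ℝ => f y / ((x : ℂ) + (y : ℂ))) (Ioi 0) ∧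
        f x = lam * ∫ y in Ioi (0 : ℝ), f y / ((x : ℂ) + (y : ℂ)))
    ↔ ∃ A B : ℂ, ∀ x : ℝ, 0 < x →
        f x = A * (x : ℂ) ^ (-α) + B * (x : ℂ) ^ (α - 1) := by
  have hpi : (Real.pi : ℂ) ≠ 0 := Complex.ofReal_ne_zero.2 Real.pi_ne_zero
  have hγ : |(1 / 2 - α).re| < 1 / 2 := by
    have : (1 / 2 - α).re = 1 / 2 - α.re := by simp
    rw [this, abs_lt]
    constructor <;> linarith
  have hγ' : |(-(1 / 2 - α)).re| < 1 / 2 := by rwa [Complex.neg_re, abs_neg]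
  have hγ0 : 1 / 2 - α ≠ 0 := sub_ne_zero.2 hα3.symm
  have hcos : Real.pi * lam = Complex.cos (Real.pi * (1 / 2 - α)) := by
    rw [hlam, mul_div_cancel₀ _ hpi, ← Complex.cos_pi_div_two_sub]
    ring_nf
  have hlam0 : lam ≠ 0 := by
    rw [hlam]
    refine div_ne_zero (fun h => ?_) hpi
    obtain ⟨k, hk⟩ := Complex.sin_eq_zero_iff.1 h
    have hk' : α = k := mul_left_cancel₀ hpi (by rw [hk, mul_comm])
    rw [hk', Complex.intCast_re] at hα1 hα2
    have h1 : 0 < k := by exact_mod_cast hα1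
    have h2 : (1 : ℝ) ≤ k := by exact_mod_cast h1
    linarith
  simp_rw [eq_cpow_iff_logTransform_eq]
  rw [stieltjes_iff_logTransform hf]
  constructor
  · intro h
    exact exists_eq_exp_of_eq_convolution hf.aestronglyMeasurable_logTransform
      hf.integrable_norm_logTransform_mul_exp hlam0 h hγ hγ0 hcos
  · rintro ⟨A, B, hAB⟩ u
    simp_rw [hAB, add_mul, mul_assoc]
    rw [integral_add ((integrable_exp_mul_sechKer hγ u).const_mul A)
      ((integrable_exp_mul_sechKer hγ' u).const_mul B), integral_const_mul, integral_const_mul,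
      integral_exp_mul_sechKer_sub hγ, integral_exp_mul_sechKer_sub hγ', mul_neg,
      Complex.cos_neg, ← hcos]
    field_simp

end
end

section
/- Let λ = 1/π. Then f ∈ E satisfies the homogeneous Stieltjes equation f(x) = λ ∫₀^∞ f(y)/(x+y) dy for all x > 0 if and only if there exist constants A, B ∈ ℂ such that f(x) = x^{-1/2}·(A + B·ln(x)) for all x > 0. -/
open MeasureTheory Set Asymptotics

noncomputable section

open Filter Topology Metric in
/-- A parametric integral of a dominated family of holomorphic functions is holomorphic. -/
theorem differentiableAt_integral_of_dominated {α : Type*} [MeasurableSpace α] {μ : Measure α}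
    {φ : ℂ → α → ℂ} {c : ℂ} {r : ℝ} {g : α → ℝ} (hr : 0 < r)
    (meas : ∀ z ∈ ball c r, AEStronglyMeasurable (φ z) μ)
    (bd : ∀ᵐ a ∂μ, ∀ z ∈ ball c r, ‖φ z a‖ ≤ g a) (hg : Integrable g μ)
    (diff : ∀ᵐ a ∂μ, DifferentiableOn ℂ (fun z => φ z a) (ball c r)) :
    DifferentiableAt ℂ (fun z => ∫ a, φ z a ∂μ) c := by
  have hc : c ∈ ball c r := mem_ball_self hr
  have hnhds : ∀ z ∈ ball c r, ball c r ∈ 𝓝 z := fun z hz => isOpen_ball.mem_nhds hz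
  refine (hasDerivAt_integral_of_dominated_loc_of_deriv_le (s := ball c (r / 2))
    (F' := fun z a => deriv (fun z => φ z a) z) (bound := fun a => g a / (r / 2))
    (ball_mem_nhds c (by positivity)) (eventually_of_mem (hnhds c hc) meas) ?_ ?_ ?_
    (hg.div_const _) ?_).2.differentiableAt
  · exact hg.mono' (meas c hc) (bd.mono fun a ha => ha c hc)
  · obtain ⟨u, -, hu0, hu⟩ := exists_seq_strictAnti_tendsto' hr
    have hu' : Tendsto (fun n => (u n : ℂ)) atTop (𝓝[≠] 0) := by
      refine tendsto_nhdsWithin_iff.2 ⟨by exact_mod_cast (Complex.continuous_ofReal.tendsto 0).comp hu,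
        Eventually.of_forall fun n => ?_⟩
      simpa using (hu0 n).1.ne'
    refine aestronglyMeasurable_of_tendsto_ae atTop
      (f := fun n a => (u n : ℂ)⁻¹ • (φ (c + u n) a - φ c a)) (fun n => ?_) ?_
    · refine ((meas _ ?_).sub (meas c hc)).const_smul ((u n : ℂ)⁻¹)
      have := hu0 n
      simp [abs_of_pos this.1, this.2]
    · filter_upwards [diff] with a ha
      exact ((ha.differentiableAt (hnhds c hc)).hasDerivAt.tendsto_slope_zero).comp hu'
  · filter_upwards [bd, diff] with a ha hd z hz
    have hsub : closedBall z (r / 2) ⊆ ball c r := fun w hw => by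
      rw [mem_ball] at hz ⊢
      rw [mem_closedBall] at hw
      linarith [dist_triangle w z c]
    refine Complex.norm_deriv_le_of_forall_mem_sphere_norm_le (by positivity)
      ((hd.mono (hsub)).diffContOnCl_ball subset_rfl) fun w hw => ha w (hsub (sphere_subset_closedBall hw))
  · filter_upwards [diff] with a hd z hz
    exact (hd.differentiableAt (hnhds z (ball_subset_ball (by linarith) hz))).hasDerivAt

open Filter Topology Metric in
/-- The integral of a divided difference of a holomorphic function along a real segment is
holomorphic. -/
theorem differentiableOn_integral_dslope {F : ℂ → ℂ} {a b : ℝ} {c : ℂ} {r R : ℝ} (hrR : r < R)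
    (hF : DifferentiableOn ℂ F (ball c R)) (hab : ∀ y ∈ Icc a b, (y : ℂ) ∈ closedBall c r) :
    DifferentiableOn ℂ (fun z => ∫ y in Icc a b, dslope F y z) (ball c r) := by
  have hsub : closedBall c r ⊆ ball c R := closedBall_subset_ball hrR
  have hd : DifferentiableOn ℂ (deriv F) (ball c R) := hF.deriv isOpen_ball
  obtain ⟨M, hM⟩ := (isCompact_closedBall c r).exists_bound_of_continuousOn
    (hd.continuousOn.mono hsub)
  have hbd : ∀ y ∈ closedBall c r, ∀ z ∈ closedBall c r, ‖dslope F y z‖ ≤ M := by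
    intro y hy z hz
    rcases eq_or_ne z y with rfl | hne
    · simpa using hM z hz
    · rw [dslope_of_ne _ hne, slope_def_field, norm_div, div_le_iff₀ (norm_pos_iff.2 (sub_ne_zero.2 hne))]
      exact (convex_closedBall c r).norm_image_sub_le_of_norm_deriv_le
        (fun x hx => hF.differentiableAt (isOpen_ball.mem_nhds (hsub hx))) hM hy hz
  intro z₀ hz₀
  obtain ⟨δ, hδ, hδsub⟩ := Metric.isOpen_iff.1 (isOpen_ball (x := c) (ε := r)) z₀ hz₀
  refine (differentiableAt_integral_of_dominated (r := δ) (g := fun _ => M) hδ ?_ ?_ ?_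
    ?_).differentiableWithinAt
  · intro z hz
    have hz' := hδsub hz
    have hcont : ContinuousOn (fun y : ℝ => dslope F z y) (Icc a b) := by
      refine ContinuousOn.comp (t := ball c R) (g := dslope F z) ?_
        Complex.continuous_ofReal.continuousOn fun y hy => hsub (hab y hy)
      exact ((Complex.differentiableOn_dslope
        (isOpen_ball.mem_nhds (hsub (ball_subset_closedBall hz')))).2 hF).continuousOn
    have hsymm : (fun y : ℝ => dslope F z y) = fun y : ℝ => dslope F y z := by
      ext y
      rcases eq_or_ne z y with h | h
      · rw [h]
      · rw [dslope_of_ne _ h, dslope_of_ne _ h.symm, slope_comm]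
    rw [← hsymm]
    exact hcont.aestronglyMeasurable measurableSet_Icc
  · filter_upwards [ae_restrict_mem measurableSet_Icc] with y hy z hz
    exact hbd y (hab y hy) z (ball_subset_closedBall (hδsub hz))
  · exact integrable_const M
  · filter_upwards [ae_restrict_mem measurableSet_Icc] with y hy
    refine ((Complex.differentiableOn_dslope (s := ball c R) ?_).2 hF).mono
      (hδsub.trans (ball_subset_closedBall.trans hsub))
    exact isOpen_ball.mem_nhds (hsub (hab y hy))

/-- The function on the slit plane obtained by evaluating `λ ∫₀^∞ f(y)/(z+y) dy`, `λ = 1/π`, at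
complex `z`. -/
def stieltjes (f : ℝ → ℂ) (z : ℂ) : ℂ :=
  1 / (Real.pi : ℂ) * ∫ y in Ioi (0 : ℝ), f y / (z + (y : ℂ))

theorem one_add_ofReal_ne_zero {y : ℝ} (hy : 0 < y) : (1 + (y : ℂ)) ≠ 0 := by
  norm_cast; positivity

theorem norm_one_add_ofReal {y : ℝ} (hy : 0 < y) : ‖(1 + (y : ℂ))‖ = 1 + y := by
  rw [← Complex.ofReal_one, ← Complex.ofReal_add, Complex.norm_real, Real.norm_of_nonneg]
  positivity

theorem norm_div_add_le {f : ℝ → ℂ} {z : ℂ} {c y : ℝ} (hy : 0 < y) (hc : 0 < c)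
    (h : c * (1 + y) ≤ ‖z + y‖) : ‖f y / (z + y)‖ ≤ 1 / c * ‖f y / (1 + (y : ℂ))‖ := by
  rw [norm_div, norm_div, norm_one_add_ofReal hy, div_mul_div_comm, one_mul]
  gcongr

theorem aestronglyMeasurable_div_add {f : ℝ → ℂ} {S : Set ℝ} (hS : MeasurableSet S)
    (hS0 : S ⊆ Ioi 0) (hf : IntegrableOn (fun y : ℝ => f y / (1 + (y : ℂ))) S) (z : ℂ) :
    AEStronglyMeasurable (fun y : ℝ => f y / (z + (y : ℂ))) (volume.restrict S) := by
  have hm : Measurable fun y : ℝ => (1 + (y : ℂ)) / (z + y) := by fun_prop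
  refine (hf.aestronglyMeasurable.mul hm.aestronglyMeasurable).congr ?_
  filter_upwards [ae_restrict_mem hS] with y hy
  exact div_mul_div_cancel₀ (one_add_ofReal_ne_zero (hS0 hy))

theorem integrableOn_div_add {f : ℝ → ℂ} {S : Set ℝ} {z : ℂ} {c : ℝ} (hS : MeasurableSet S)
    (hS0 : S ⊆ Ioi 0) (hf : IntegrableOn (fun y : ℝ => f y / (1 + (y : ℂ))) S) (hc : 0 < c)
    (h : ∀ y ∈ S, c * (1 + y) ≤ ‖z + y‖) :
    IntegrableOn (fun y : ℝ => f y / (z + (y : ℂ))) S := by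
  refine (hf.norm.const_mul (1 / c)).mono' (aestronglyMeasurable_div_add hS hS0 hf z) ?_
  filter_upwards [ae_restrict_mem hS] with y hy
  exact norm_div_add_le (hS0 hy) hc (h y hy)

open Metric in
theorem differentiableAt_setIntegral_div_add {f : ℝ → ℂ} {S : Set ℝ} {z : ℂ} {c : ℝ}
    (hS : MeasurableSet S) (hS0 : S ⊆ Ioi 0)
    (hf : IntegrableOn (fun y : ℝ => f y / (1 + (y : ℂ))) S) (hc : 0 < c)
    (h : ∀ y ∈ S, c * (1 + y) ≤ ‖z + y‖) :
    DifferentiableAt ℂ (fun z => ∫ y in S, f y / (z + (y : ℂ))) z := by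
  have key : ∀ y ∈ S, ∀ w ∈ ball z (c / 2), c / 2 * (1 + y) ≤ ‖w + y‖ := by
    intro y hy w hw
    have h1 : ‖z + y‖ ≤ ‖w + y‖ + ‖w - z‖ := by
      calc ‖z + y‖ = ‖(w + y) - (w - z)‖ := by congr 1; ring
        _ ≤ _ := norm_sub_le _ _
    rw [mem_ball, dist_eq_norm] at hw
    have h2 := h y hy
    have h3 : 0 < y := hS0 hy
    nlinarith
  refine differentiableAt_integral_of_dominated (r := c / 2)
    (g := fun y => 1 / (c / 2) * ‖f y / (1 + (y : ℂ))‖) (by positivity)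
    (fun w _ => aestronglyMeasurable_div_add hS hS0 hf w) ?_ (hf.norm.const_mul _) ?_
  · filter_upwards [ae_restrict_mem hS] with y hy w hw
    exact norm_div_add_le (hS0 hy) (by positivity) (key y hy w hw)
  · filter_upwards [ae_restrict_mem hS] with y hy w hw
    have h3 : 0 < y := hS0 hy
    have : w + y ≠ 0 := norm_pos_iff.1 (lt_of_lt_of_le (by positivity) (key y hy w hw))
    fun_prop (disch := exact this)

theorem norm_add_le_two_mul_norm_add_ofReal {z : ℂ} (hz : 0 ≤ z.re) {y : ℝ} (hy : 0 < y) :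
    ‖z‖ + y ≤ 2 * ‖z + y‖ := by
  have h1 : ‖z‖ ≤ ‖z + y‖ := by
    refine abs_le_of_sq_le_sq' ?_ (norm_nonneg _) |>.2
    rw [← Complex.normSq_eq_norm_sq, ← Complex.normSq_eq_norm_sq, Complex.normSq_apply,
      Complex.normSq_apply]
    simp
    nlinarith [mul_nonneg hz hy.le]
  have h2 : y ≤ ‖z + y‖ := by
    refine le_trans ?_ (Complex.re_le_norm _)
    simpa
  linarith

theorem norm_add_mul_abs_im_le (z : ℂ) {y : ℝ} (hy : 0 < y) :
    (‖z‖ + y) * |z.im| ≤ 3 * ‖z‖ * ‖z + y‖ := by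
  have h1 : |z.im| ≤ ‖z + y‖ := by simpa using Complex.abs_im_le_norm (z + y)
  have h2 : y ≤ ‖z + y‖ + ‖z‖ := by
    calc y = ‖(y : ℂ)‖ := by rw [Complex.norm_real, Real.norm_of_nonneg hy.le]
      _ = ‖(z + y) - z‖ := by congr 1; ring
      _ ≤ _ := norm_sub_le _ _
  have h3 : |z.im| ≤ ‖z‖ := Complex.abs_im_le_norm z
  have h4 := norm_nonneg z
  have h5 := abs_nonneg z.im
  have h6 := norm_nonneg (z + y)
  nlinarith [mul_le_mul_of_nonneg_right h2 h5, mul_le_mul_of_nonneg_left h3 h6,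
    mul_le_mul_of_nonneg_left h1 h4]

theorem min_one_mul_one_add_le {r y : ℝ} (hr : 0 < r) (hy : 0 < y) :
    r / (r + 1) * (1 + y) ≤ r + y := by
  rw [div_mul_eq_mul_div, div_le_iff₀ (by positivity)]
  nlinarith [mul_pos hr hy, mul_pos hr hr]

theorem exists_mul_one_add_le_norm_add {z : ℂ} (hz : z ∈ Complex.slitPlane) :
    ∃ c : ℝ, 0 < c ∧ ∀ y : ℝ, 0 < y → c * (1 + y) ≤ ‖z + y‖ := by
  have hz0 : 0 < ‖z‖ := norm_pos_iff.2 (Complex.slitPlane_ne_zero hz)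
  rcases hz with hz | hz
  · refine ⟨‖z‖ / (‖z‖ + 1) / 2, by positivity, fun y hy => ?_⟩
    linarith [norm_add_le_two_mul_norm_add_ofReal hz.le hy, min_one_mul_one_add_le hz0 hy]
  · have hz' : 0 < |z.im| := abs_pos.2 hz
    refine ⟨‖z‖ / (‖z‖ + 1) * |z.im| / (3 * ‖z‖), by positivity, fun y hy => ?_⟩
    rw [div_mul_eq_mul_div, div_le_iff₀ (by positivity)]
    have h1 := norm_add_mul_abs_im_le z hy
    have h2 := mul_le_mul_of_nonneg_right (min_one_mul_one_add_le hz0 hy) hz'.le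
    linarith

theorem differentiableAt_stieltjes {f : ℝ → ℂ} (hf : MemE f) {z : ℂ} (hz : z ∈ Complex.slitPlane) :
    DifferentiableAt ℂ (stieltjes f) z := by
  obtain ⟨c, hc, h⟩ := exists_mul_one_add_le_norm_add hz
  exact (differentiableAt_setIntegral_div_add measurableSet_Ioi subset_rfl hf hc
    fun y hy => h y hy).const_mul _

theorem norm_stieltjes_mul_abs_im_le {f : ℝ → ℂ} (hf : MemE f) :
    ∃ C : ℝ, 0 ≤ C ∧ ∀ z : ℂ, ‖stieltjes f z‖ * |z.im| ≤ C * (‖z‖ + 1) := by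
  refine ⟨‖1 / (Real.pi : ℂ)‖ * (3 * ∫ y in Ioi (0 : ℝ), ‖f y / (1 + (y : ℂ))‖), ?_, fun z => ?_⟩
  · have : 0 ≤ ∫ y in Ioi (0 : ℝ), ‖f y / (1 + (y : ℂ))‖ :=
      integral_nonneg fun _ => norm_nonneg _
    positivity
  rw [stieltjes, norm_mul, mul_assoc, mul_assoc]
  refine mul_le_mul_of_nonneg_left ?_ (norm_nonneg _)
  rcases eq_or_ne z.im 0 with h0 | h0
  · have : 0 ≤ ∫ y in Ioi (0 : ℝ), ‖f y / (1 + (y : ℂ))‖ :=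
      integral_nonneg fun _ => norm_nonneg _
    rw [h0, abs_zero, mul_zero]
    positivity
  have hz' : 0 < |z.im| := abs_pos.2 h0
  have hz0 : 0 < ‖z‖ := hz'.trans_le (Complex.abs_im_le_norm z)
  rw [← le_div_iff₀ hz']
  calc ‖∫ y in Ioi (0 : ℝ), f y / (z + y)‖
      ≤ ∫ y in Ioi (0 : ℝ), 3 * (‖z‖ + 1) / |z.im| * ‖f y / (1 + (y : ℂ))‖ := by
        refine norm_integral_le_of_norm_le (hf.norm.const_mul _) ?_
        filter_upwards [ae_restrict_mem measurableSet_Ioi] with y hy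
        have := norm_div_add_le (f := f) (z := z) (c := |z.im| / (3 * (‖z‖ + 1))) hy (by positivity) ?_
        · simpa using this
        · rw [div_mul_eq_mul_div, div_le_iff₀ (by positivity)]
          have h1 := norm_add_mul_abs_im_le z hy
          have h2 := mul_le_mul_of_nonneg_right (min_one_mul_one_add_le hz0 hy) hz'.le
          rw [div_mul_eq_mul_div, div_mul_eq_mul_div, div_le_iff₀ (by positivity)] at h2
          have h3 := mul_le_mul_of_nonneg_right h1 (by positivity : 0 ≤ ‖z‖ + 1)
          nlinarith
    _ = _ := by rw [integral_const_mul]; ring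

theorem Complex.log_neg_of_im_pos {z : ℂ} (hz : 0 < z.im) :
    Complex.log (-z) = Complex.log z - Real.pi * Complex.I := by
  rw [Complex.log, Complex.log, Complex.arg_neg_eq_arg_sub_pi_of_im_pos hz, norm_neg]
  push_cast
  ring

theorem Complex.log_neg_of_im_neg {z : ℂ} (hz : z.im < 0) :
    Complex.log (-z) = Complex.log z + Real.pi * Complex.I := by
  rw [Complex.log, Complex.log, Complex.arg_neg_eq_arg_add_pi_of_im_neg hz, norm_neg]
  push_cast
  ring

theorem integral_Icc_one_div_sub {a b : ℝ} (hab : a ≤ b) {z : ℂ} (hz : z.im ≠ 0) :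
    ∫ y in Icc a b, 1 / ((y : ℂ) - z) = Complex.log (b - z) - Complex.log (a - z) := by
  have hs : ∀ y : ℝ, (y : ℂ) - z ∈ Complex.slitPlane := fun y => Or.inr (by simpa using hz)
  rw [integral_Icc_eq_integral_Ioc, ← intervalIntegral.integral_of_le hab]
  refine intervalIntegral.integral_eq_sub_of_hasDerivAt (f := fun y : ℝ => Complex.log (y - z))
    (fun y _ => ?_) ?_
  · exact ((Complex.ofRealCLM.hasDerivAt (x := y)).sub_const z).clog_real (hs y)
  · refine Continuous.intervalIntegrable ?_ _ _
    exact continuous_const.div (by fun_prop) fun y => Complex.slitPlane_ne_zero (hs y)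

open Metric in
/-- Near the cut, the transform of a fixed point `f` differs from a holomorphic function by
`± i` times the (analytic continuation of the) density. -/
theorem exists_analyticAt_stieltjes_neg {f : ℝ → ℂ} (hf : MemE f)
    (hfix : ∀ x : ℝ, 0 < x → f x = stieltjes f x) {x : ℝ} (hx : 0 < x) :
    ∃ A : ℂ → ℂ, AnalyticAt ℂ A x ∧ ∀ᶠ z in nhds (x : ℂ),
      (0 < z.im → stieltjes f (-z) = A z + Complex.I * stieltjes f z) ∧
      (z.im < 0 → stieltjes f (-z) = A z - Complex.I * stieltjes f z) := by
  obtain ⟨ρ, hρ⟩ : ∃ ρ, ρ = x / 4 := ⟨_, rfl⟩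
  have hρ0 : 0 < ρ := by rw [hρ]; positivity
  set a := x - ρ with ha
  set b := x + ρ with hb
  set S := Ioi (0 : ℝ) \ Icc a b with hS
  have hSm : MeasurableSet S := measurableSet_Ioi.diff measurableSet_Icc
  have hball : ball (x : ℂ) (2 * ρ) ⊆ Complex.slitPlane := by
    intro z hz
    left
    rw [mem_ball, dist_eq_norm] at hz
    have := (abs_le.1 (Complex.abs_re_le_norm (z - x))).1
    simp at this
    linarith
  have hF : DifferentiableOn ℂ (stieltjes f) (ball (x : ℂ) (2 * ρ)) := fun z hz =>
    (differentiableAt_stieltjes hf (hball hz)).differentiableWithinAt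
  have hJ : DifferentiableOn ℂ (fun z => ∫ y in Icc a b, dslope (stieltjes f) y z)
      (ball (x : ℂ) ρ) := by
    refine differentiableOn_integral_dslope (by linarith) hF fun y hy => ?_
    rw [mem_closedBall, dist_eq_norm, ← Complex.ofReal_sub, Complex.norm_real, Real.norm_eq_abs,
      abs_le]
    constructor <;> linarith [hy.1, hy.2]
  have hout : ∀ z ∈ ball (x : ℂ) (ρ / 2),
      DifferentiableAt ℂ (fun z => ∫ y in S, f y / (-z + (y : ℂ))) z := by
    intro z hz
    refine DifferentiableAt.comp z (g := fun z => ∫ y in S, f y / (z + (y : ℂ)))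
      (differentiableAt_setIntegral_div_add (c := 1 / (1 + (2 * x + 1) * (2 / ρ))) hSm sdiff_subset
        (hf.mono_set sdiff_subset) (by positivity) ?_) differentiable_neg.differentiableAt
    intro y hy
    rw [mem_ball, dist_eq_norm] at hz
    have hyx : ρ < ‖(y : ℂ) - x‖ := by
      rw [← Complex.ofReal_sub, Complex.norm_real, Real.norm_eq_abs, lt_abs]
      by_contra! h
      exact hy.2 ⟨by linarith, by linarith⟩
    have h1 : ‖(y : ℂ) - x‖ ≤ ‖-z + y‖ + ‖z - x‖ := by
      calc _ = ‖(-z + y) + (z - x)‖ := by congr 1; ring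
        _ ≤ _ := norm_add_le _ _
    have h2 : y ≤ ‖(y : ℂ) - x‖ + x := by
      have := Complex.re_le_norm ((y : ℂ) - x)
      simp at this
      linarith
    have h3 : 1 ≤ ‖-z + y‖ * (2 / ρ) := by
      rw [mul_div_assoc', le_div_iff₀ hρ0]
      linarith
    rw [div_mul_eq_mul_div, div_le_iff₀ (by positivity)]
    nlinarith
  refine ⟨fun z => 1 / (Real.pi : ℂ) * ((∫ y in S, f y / (-z + (y : ℂ))) +
    (∫ y in Icc a b, dslope (stieltjes f) y z) +
    stieltjes f z * (Complex.log (b - z) - Complex.log (z - a))), ?_, ?_⟩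
  · refine DifferentiableOn.analyticAt (s := ball (x : ℂ) (ρ / 2)) (fun z hz => ?_)
      (ball_mem_nhds _ (by positivity))
    have hz2 : z ∈ ball (x : ℂ) ρ := ball_subset_ball (by linarith) hz
    have hd : z ∈ ball (x : ℂ) (2 * ρ) := ball_subset_ball (by linarith) hz
    rw [mem_ball, dist_eq_norm] at hz2
    have hre := abs_lt.1 ((Complex.abs_re_le_norm (z - x)).trans_lt hz2)
    simp only [Complex.sub_re, Complex.ofReal_re] at hre
    have hb' : (b : ℂ) - z ∈ Complex.slitPlane := by
      left
      rw [Complex.sub_re, Complex.ofReal_re]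
      linarith
    have ha' : z - (a : ℂ) ∈ Complex.slitPlane := by
      left
      rw [Complex.sub_re, Complex.ofReal_re]
      linarith
    have h1 := hout z hz
    have h2 := (hJ.differentiableAt (isOpen_ball.mem_nhds (ball_subset_ball (by linarith) hz)))
    have h3 := differentiableAt_stieltjes hf (hball hd)
    have h4 : DifferentiableAt ℂ (fun z => Complex.log (b - z) - Complex.log (z - a)) z :=
      ((differentiableAt_id.const_sub _).clog hb').sub ((differentiableAt_id.sub_const _).clog ha')
    exact (((h1.add h2).add (h3.mul h4)).const_mul _).differentiableWithinAt
  · have key : ∀ z : ℂ, z.im ≠ 0 → stieltjes f (-z) = 1 / (Real.pi : ℂ) *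
        ((∫ y in S, f y / (-z + (y : ℂ))) + (∫ y in Icc a b, dslope (stieltjes f) y z) +
        stieltjes f z * (Complex.log (b - z) - Complex.log (a - z))) := by
      intro z hz
      obtain ⟨c, hc, hcz⟩ := exists_mul_one_add_le_norm_add (z := -z) (Or.inr (by simpa using hz))
      have hint : IntegrableOn (fun y : ℝ => f y / (-z + (y : ℂ))) (Ioi 0) :=
        integrableOn_div_add measurableSet_Ioi subset_rfl hf hc fun y hy => hcz y hy
      have hsub : Icc a b ⊆ Ioi 0 := fun y hy => lt_of_lt_of_le (by linarith) hy.1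
      have hne : ∀ y : ℝ, (y : ℂ) - z ≠ 0 := fun y h => hz (by simpa using congrArg Complex.im h)
      have hint2 : IntegrableOn (fun y : ℝ => stieltjes f z * (1 / ((y : ℂ) - z))) (Icc a b) :=
        ContinuousOn.integrableOn_Icc (continuous_const.mul (continuous_const.div (by fun_prop)
          hne)).continuousOn
      have hds : ∫ y in Icc a b, dslope (stieltjes f) y z = ∫ y in Icc a b,
          (f y / (-z + (y : ℂ)) - stieltjes f z * (1 / ((y : ℂ) - z))) := by
        refine setIntegral_congr_fun measurableSet_Icc fun y hy => ?_
        have h1 : z - y ≠ 0 := fun h => hne y (by rw [← neg_sub, h, neg_zero])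
        have h2 := hne y
        have h3 : -z + (y : ℂ) ≠ 0 := by rwa [neg_add_eq_sub]
        rw [dslope_of_ne _ (sub_ne_zero.1 h1), slope_def_field, hfix y (hsub hy)]
        rw [neg_add_eq_sub, ← neg_sub (y : ℂ) z]
        field_simp
        ring
      rw [hds, integral_sub (hint.mono_set hsub) hint2, integral_const_mul,
        integral_Icc_one_div_sub (by linarith) hz, stieltjes,
        ← integral_inter_add_sdiff measurableSet_Icc hint, inter_eq_right.2 hsub]
      ring
    have hpi : (Real.pi : ℂ) ≠ 0 := by exact_mod_cast Real.pi_ne_zero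
    refine Filter.Eventually.of_forall fun z => ⟨fun hz => ?_, fun hz => ?_⟩
    · rw [key z hz.ne', ← neg_sub z (a : ℂ), Complex.log_neg_of_im_pos (by simpa using hz)]
      field_simp
      ring
    · rw [key z hz.ne, ← neg_sub z (a : ℂ), Complex.log_neg_of_im_neg (by simpa using hz)]
      field_simp
      ring

open Filter Topology in
theorem eq_const_of_differentiableAt_of_norm_le {K : ℂ → ℂ} {M : ℝ}
    (hK : ∀ z ≠ 0, DifferentiableAt ℂ K z)
    (hM : ∀ z ≠ 0, ‖K z‖ ≤ M * (‖z‖ + 1) / √‖z‖) : ∃ c, ∀ z ≠ 0, K z = c := by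
  have hM0 : 0 ≤ M := by
    have := (norm_nonneg _).trans (hM 1 one_ne_zero)
    norm_num at this
    linarith
  have hlittle : (fun z => K z - K 0) =o[𝓝[≠] 0] fun z => (z - 0)⁻¹ := by
    rw [isLittleO_iff_tendsto' (eventually_nhdsWithin_of_forall fun z hz h => by simp_all)]
    have hlim : Tendsto (fun z : ℂ => M * (‖z‖ + 1) * √‖z‖ + ‖K 0‖ * ‖z‖) (𝓝[≠] 0) (𝓝 0) := by
      have : Continuous fun z : ℂ => M * (‖z‖ + 1) * √‖z‖ + ‖K 0‖ * ‖z‖ := by fun_prop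
      simpa using (this.tendsto 0).mono_left nhdsWithin_le_nhds
    refine squeeze_zero_norm' (eventually_nhdsWithin_of_forall fun z hz => ?_) hlim
    have hz0 : 0 < ‖z‖ := norm_pos_iff.2 hz
    rw [sub_zero, div_inv_eq_mul, norm_mul]
    calc ‖K z - K 0‖ * ‖z‖ ≤ (M * (‖z‖ + 1) / √‖z‖ + ‖K 0‖) * ‖z‖ := by
          gcongr
          exact (norm_sub_le _ _).trans (by gcongr; exact hM z hz)
      _ = M * (‖z‖ + 1) * (‖z‖ / √‖z‖) + ‖K 0‖ * ‖z‖ := by ring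
      _ = _ := by rw [Real.div_sqrt]
  have hE := Complex.differentiableOn_update_limUnder_of_isLittleO (s := univ) univ_mem
    (fun z hz => (hK z (by simpa using hz)).differentiableWithinAt) hlittle
  set E := Function.update K 0 (limUnder (𝓝[≠] 0) K) with hEdef
  have hEK : ∀ z ≠ 0, E z = K z := fun z hz => Function.update_of_ne hz _ _
  have hD : Differentiable ℂ (dslope E 0) := by
    rw [← differentiableOn_univ]
    exact (Complex.differentiableOn_dslope univ_mem).2 hE
  have hT : Tendsto (dslope E 0) (cocompact ℂ) (𝓝 0) := by
    have hlim : Tendsto (fun t : ℝ => 2 * M * (√t)⁻¹ + ‖E 0‖ * t⁻¹) atTop (𝓝 0) := by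
      simpa using ((tendsto_inv_atTop_zero.comp Real.tendsto_sqrt_atTop).const_mul (2 * M)).add
        (tendsto_inv_atTop_zero.const_mul ‖E 0‖)
    refine squeeze_zero_norm' ?_ (hlim.comp (tendsto_norm_cocompact_atTop))
    filter_upwards [(tendsto_norm_cocompact_atTop).eventually_ge_atTop 1] with z hz
    have hz0 : 0 < ‖z‖ := by linarith
    have hz' : z ≠ 0 := norm_pos_iff.1 hz0
    rw [dslope_of_ne _ hz', slope_def_field, norm_div, sub_zero, Function.comp, div_eq_mul_inv]
    calc ‖E z - E 0‖ * ‖z‖⁻¹ ≤ (2 * M * (‖z‖ / √‖z‖) + ‖E 0‖) * ‖z‖⁻¹ := by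
          gcongr
          refine (norm_sub_le _ _).trans ?_
          gcongr
          rw [hEK z hz', mul_div_assoc']
          refine (hM z hz').trans ?_
          gcongr ?_ / _
          nlinarith
      _ = _ := by field_simp
  refine ⟨E 0, fun z hz => ?_⟩
  have h := hD.apply_eq_of_tendsto_cocompact z hT
  rw [dslope_of_ne _ hz, slope_def_field, sub_zero, div_eq_zero_iff, or_iff_left hz, hEK z hz] at h
  exact sub_eq_zero.1 h

open Metric in
theorem norm_le_of_norm_mul_abs_im_le {K : ℂ → ℂ} {B : ℝ} {w : ℂ} (hw : w ≠ 0)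
    (hK : ∀ z ≠ 0, DifferentiableAt ℂ K z)
    (hB : ∀ z, ‖w‖ / 4 ≤ ‖z‖ → ‖z‖ ≤ 2 * ‖w‖ → ‖K z‖ * |z.im| ≤ B) :
    ‖K w‖ ≤ 4 * B / ‖w‖ := by
  have hr : 0 < ‖w‖ := norm_pos_iff.2 hw
  rw [le_div_iff₀ hr]
  rcases le_or_gt (‖w‖ / 4) |w.im| with him | him
  · have h1 := hB w (by linarith) (by linarith)
    have h2 := mul_le_mul_of_nonneg_left him (norm_nonneg (K w))
    linarith
  set s := ‖w‖ / 2 with hs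
  have hs0 : 0 < s := by positivity
  have hre : 3 * ‖w‖ / 4 ≤ |w.re| := by linarith [Complex.norm_le_abs_re_add_abs_im w]
  have hre' : |w.re| ≤ ‖w‖ := Complex.abs_re_le_norm w
  have hnorm : ‖(w.re : ℂ)‖ = |w.re| := Complex.norm_real _
  have hlow : ∀ z ∈ closedBall (w.re : ℂ) s, ‖w‖ / 4 ≤ ‖z‖ ∧ ‖z‖ ≤ 2 * ‖w‖ := by
    intro z hz
    rw [mem_closedBall, dist_eq_norm] at hz
    have h1 := norm_sub_norm_le (w.re : ℂ) z
    have h2 := norm_sub_norm_le z (w.re : ℂ)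
    rw [norm_sub_rev] at h1
    constructor <;> linarith
  have hdiff : DiffContOnCl ℂ (fun z => K z * ((z - w.re) ^ 2 - (s : ℂ) ^ 2))
      (ball (w.re : ℂ) s) := by
    refine DifferentiableOn.diffContOnCl_ball (U := closedBall (w.re : ℂ) s) (fun z hz => ?_)
      subset_rfl
    have hz0 : z ≠ 0 := norm_pos_iff.1 (lt_of_lt_of_le (by positivity) (hlow z hz).1)
    exact ((hK z hz0).mul (by fun_prop)).differentiableWithinAt
  have hmax := Complex.norm_le_of_forall_mem_frontier_norm_le (C := 2 * s * B) (z := w)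
    isBounded_ball hdiff ?_ ?_
  · have hww : w - (w.re : ℂ) = w.im * Complex.I := by
      apply Complex.ext <;> simp
    have hnw : ‖(w - (w.re : ℂ)) ^ 2 - (s : ℂ) ^ 2‖ = w.im ^ 2 + s ^ 2 := by
      rw [hww, mul_pow, Complex.I_sq, mul_neg_one, ← neg_add', norm_neg]
      norm_cast
      rw [Real.norm_of_nonneg (by positivity)]
    rw [norm_mul, hnw] at hmax
    have h3 : ‖K w‖ * s ^ 2 ≤ 2 * s * B :=
      le_trans (by gcongr; nlinarith [sq_nonneg w.im]) hmax
    have h4 : ‖K w‖ * s ≤ 2 * B := by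
      refine le_of_mul_le_mul_right ?_ hs0
      linarith
    have h5 : ‖K w‖ * ‖w‖ = 2 * (‖K w‖ * s) := by rw [hs]; ring
    linarith
  · intro z hz
    rw [frontier_ball _ hs0.ne'] at hz
    have hz' := hlow z (sphere_subset_closedBall hz)
    rw [mem_sphere, dist_eq_norm] at hz
    have hid : (z - w.re) ^ 2 - (s : ℂ) ^ 2 = (z - w.re) * (2 * z.im * Complex.I) := by
      have h1 : (s : ℂ) ^ 2 = (z - w.re) * (starRingEnd ℂ) (z - w.re) := by
        rw [Complex.mul_conj, Complex.normSq_eq_norm_sq, hz]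
        push_cast
        rfl
      have h2 : (z - w.re) - (starRingEnd ℂ) (z - w.re) = 2 * z.im * Complex.I := by
        rw [Complex.sub_conj]
        simp
      rw [h1, ← h2]
      ring
    rw [hid]
    simp only [norm_mul, hz, Complex.norm_I, Complex.norm_real, Real.norm_eq_abs, Complex.norm_ofNat,
      mul_one]
    nlinarith [hB z hz'.1 hz'.2]
  · refine subset_closure ?_
    have : w - (w.re : ℂ) = w.im * Complex.I := by
      apply Complex.ext <;> simp
    rw [mem_ball, dist_eq_norm, this, norm_mul, Complex.norm_I, mul_one, Complex.norm_real,
      Real.norm_eq_abs]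
    linarith

open Filter Topology in
theorem neBot_nhdsWithin_im_ne_zero (z : ℂ) : (𝓝[{w : ℂ | w.im ≠ 0}] z).NeBot := by
  rw [← mem_closure_iff_nhdsWithin_neBot]
  rcases le_total 0 z.im with h | h
  · refine closure_mono (s := {w : ℂ | 0 < w.im}) (fun w hw => ne_of_gt hw) ?_
    rwa [Complex.closure_setOfPred_lt_im]
  · refine closure_mono (s := {w : ℂ | w.im < 0}) (fun w hw => ne_of_lt hw) ?_
    rwa [Complex.closure_setOfPred_im_lt]

open Filter Topology in
/-- A function holomorphic off the real axis that extends holomorphically across each point of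
`ℂ \ {0}` agrees off the real axis with a function holomorphic on `ℂ \ {0}`. -/
theorem exists_differentiableAt_extension {K : ℂ → ℂ}
    (h : ∀ z ≠ 0, ∃ a : ℂ → ℂ, AnalyticAt ℂ a z ∧ ∀ᶠ w in 𝓝 z, w.im ≠ 0 → K w = a w) :
    ∃ E : ℂ → ℂ, (∀ z ≠ 0, DifferentiableAt ℂ E z) ∧ ∀ z, z.im ≠ 0 → E z = K z := by
  classical
  refine ⟨fun z => if z.im ≠ 0 then K z else limUnder (𝓝[{w : ℂ | w.im ≠ 0}] z) K,
    fun z hz => ?_, fun z hz => if_pos hz⟩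
  obtain ⟨a, ha, haK⟩ := h z hz
  refine ha.differentiableAt.congr_of_eventuallyEq ?_
  filter_upwards [ha.eventually_analyticAt, haK.eventually_nhds] with w hw hwK
  by_cases him : w.im = 0
  · rw [if_neg (not_not.2 him)]
    have := neBot_nhdsWithin_im_ne_zero w
    refine Tendsto.limUnder_eq ((hw.continuousAt.tendsto.mono_left nhdsWithin_le_nhds).congr' ?_)
    filter_upwards [mem_nhdsWithin_of_mem_nhds hwK, self_mem_nhdsWithin] with v hv hv'
    exact (hv hv').symm
  · rw [if_pos him]
    exact hwK.self_of_nhds him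

open Filter Topology in
theorem eq_const_of_even_of_norm_mul_abs_im_le {K : ℂ → ℂ} {C : ℝ}
    (heven : ∀ z, 0 < z.im → K (-z) = K z) (hd : ∀ z, 0 < z.im → DifferentiableAt ℂ K z)
    (hreal : ∀ x : ℝ, 0 < x →
      ∃ a : ℂ → ℂ, AnalyticAt ℂ a x ∧ ∀ᶠ z in 𝓝 (x : ℂ), z.im ≠ 0 → K z = a z)
    (hC : ∀ z, z.im ≠ 0 → ‖K z‖ * |z.im| ≤ C * (√‖z‖ * (‖z‖ + 1))) :
    ∃ c, ∀ z, z.im ≠ 0 → K z = c := by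
  have heven' : ∀ z : ℂ, z.im ≠ 0 → K z = K (-z) := by
    intro z hz
    rcases lt_or_gt_of_ne hz with hz | hz
    · rw [← heven (-z) (by simpa using hz), neg_neg]
    · rw [heven z hz]
  have hneg : ∀ z : ℂ,
      (∃ a : ℂ → ℂ, AnalyticAt ℂ a (-z) ∧ ∀ᶠ w in 𝓝 (-z), w.im ≠ 0 → K w = a w) →
      ∃ a : ℂ → ℂ, AnalyticAt ℂ a z ∧ ∀ᶠ w in 𝓝 z, w.im ≠ 0 → K w = a w := by
    rintro z ⟨a, ha, haK⟩
    refine ⟨fun w => a (-w), ha.comp analyticAt_id.neg, ?_⟩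
    filter_upwards [(continuous_neg.tendsto z).eventually haK] with w hw hwi
    rw [heven' w hwi, hw (by simpa using hwi)]
  have hup : ∀ z : ℂ, 0 < z.im →
      ∃ a : ℂ → ℂ, AnalyticAt ℂ a z ∧ ∀ᶠ w in 𝓝 z, w.im ≠ 0 → K w = a w := fun z hz =>
    ⟨K, DifferentiableOn.analyticAt (s := {w : ℂ | 0 < w.im})
      (fun w hw => (hd w hw).differentiableWithinAt)
      ((isOpen_lt continuous_const Complex.continuous_im).mem_nhds hz),
      Eventually.of_forall fun _ _ => rfl⟩
  obtain ⟨E, hE, hEK⟩ := exists_differentiableAt_extension (K := K) fun z hz => by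
    rcases lt_trichotomy z.im 0 with him | him | him
    · exact hneg z (hup _ (by simpa using him))
    · have hzre : z = (z.re : ℂ) := Complex.ext rfl (by simpa using him)
      have hre : z.re ≠ 0 := fun h => hz (by rw [hzre, h, Complex.ofReal_zero])
      rcases lt_or_gt_of_ne hre with hre | hre
      · refine hneg z ?_
        rw [hzre, ← Complex.ofReal_neg]
        exact hreal _ (by linarith)
      · rw [hzre]
        exact hreal _ hre
    · exact hup z him
  have hC0 : 0 ≤ C := by
    have := (mul_nonneg (norm_nonneg _) (abs_nonneg _)).trans (hC Complex.I (by simp))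
    norm_num at this
    linarith
  obtain ⟨c, hc⟩ := eq_const_of_differentiableAt_of_norm_le (M := 16 * C) hE fun w hw => by
    have hr : 0 < ‖w‖ := norm_pos_iff.2 hw
    refine (norm_le_of_norm_mul_abs_im_le (B := C * (2 * √‖w‖ * (2 * (‖w‖ + 1)))) hw hE
      fun z _ hz => ?_).trans (le_of_eq ?_)
    · rcases eq_or_ne z.im 0 with him | him
      · rw [him, abs_zero, mul_zero]
        positivity
      · rw [hEK z him]
        refine (hC z him).trans ?_
        gcongr
        · rw [Real.sqrt_le_left (by positivity), mul_pow, Real.sq_sqrt hr.le]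
          linarith
        · linarith
    · have := Real.sq_sqrt hr.le
      have hs : √‖w‖ ≠ 0 := (Real.sqrt_pos.2 hr).ne'
      rw [div_eq_div_iff hr.ne' hs]
      linear_combination 16 * C * (‖w‖ + 1) * this
  exact ⟨c, fun z hz => by rw [← hEK z hz, hc z (fun h => hz (by rw [h, Complex.zero_im]))]⟩

theorem cpow_half_neg_of_im_pos {z : ℂ} (hz : 0 < z.im) :
    (-z) ^ (1 / 2 : ℂ) = -Complex.I * z ^ (1 / 2 : ℂ) := by
  have hz0 : z ≠ 0 := fun h => by simp [h] at hz
  rw [Complex.cpow_def_of_ne_zero hz0, Complex.cpow_def_of_ne_zero (neg_ne_zero.2 hz0),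
    Complex.log_neg_of_im_pos hz, ← Complex.exp_neg_pi_div_two_mul_I, ← Complex.exp_add]
  congr 1
  ring

theorem norm_cpow_half (z : ℂ) : ‖z ^ (1 / 2 : ℂ)‖ = √‖z‖ := by
  rw [Real.sqrt_eq_rpow, ← Complex.norm_cpow_real]
  norm_num

theorem differentiableAt_cpow_half {z : ℂ} (hz : z ∈ Complex.slitPlane) :
    DifferentiableAt ℂ (fun z : ℂ => z ^ (1 / 2 : ℂ)) z :=
  differentiableAt_id.cpow_const hz

/-- The combination `√z (F(z) + i F(-z))` is constant on the upper half-plane. -/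
theorem exists_cpow_half_mul_stieltjes_add_eq {f : ℝ → ℂ} (hf : MemE f)
    (hfix : ∀ x : ℝ, 0 < x → f x = stieltjes f x) :
    ∃ c : ℂ, ∀ z : ℂ, 0 < z.im →
      z ^ (1 / 2 : ℂ) * (stieltjes f z + Complex.I * stieltjes f (-z)) = c := by
  obtain ⟨C, hC0, hC⟩ := norm_stieltjes_mul_abs_im_le hf
  suffices hconst : ∃ c, ∀ z : ℂ, z.im ≠ 0 → (z ^ (1 / 2 : ℂ) *
      if 0 < z.im then stieltjes f z + Complex.I * stieltjes f (-z)
      else Complex.I * stieltjes f (-z) - stieltjes f z) = c by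
    obtain ⟨c, hc⟩ := hconst
    exact ⟨c, fun z hz => by rw [← hc z hz.ne', if_pos hz]⟩
  refine eq_const_of_even_of_norm_mul_abs_im_le (C := 2 * C) ?_ ?_ ?_ ?_
  · intro z hz
    have hz' : ¬ 0 < (-z).im := by simpa using hz.le
    simp only [hz, hz', if_true, if_false, neg_neg, cpow_half_neg_of_im_pos hz]
    linear_combination -z ^ (1 / 2 : ℂ) * stieltjes f z * Complex.I_sq
  · intro z hz
    have h1 : z ∈ Complex.slitPlane := Or.inr hz.ne'
    have h2 : -z ∈ Complex.slitPlane := Or.inr (by simpa using hz.ne')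
    have h3 : DifferentiableAt ℂ (fun z => z ^ (1 / 2 : ℂ) *
        (stieltjes f z + Complex.I * stieltjes f (-z))) z :=
      (differentiableAt_cpow_half h1).mul ((differentiableAt_stieltjes hf h1).add
        (((differentiableAt_stieltjes hf h2).comp z
          differentiable_neg.differentiableAt).const_mul _))
    refine h3.congr_of_eventuallyEq ?_
    filter_upwards [(isOpen_lt continuous_const Complex.continuous_im).mem_nhds hz] with w hw
    rw [if_pos hw]
  · intro x hx
    obtain ⟨A, hA, hAF⟩ := exists_analyticAt_stieltjes_neg hf hfix hx
    refine ⟨fun z => z ^ (1 / 2 : ℂ) * (Complex.I * A z), ?_, ?_⟩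
    · exact (analyticAt_id.cpow analyticAt_const (by simp [hx])).mul (analyticAt_const.mul hA)
    · filter_upwards [hAF] with z hz him
      rcases lt_or_gt_of_ne him with him | him
      · rw [if_neg him.not_gt, hz.2 him]
        linear_combination -z ^ (1 / 2 : ℂ) * stieltjes f z * Complex.I_sq
      · rw [if_pos him, hz.1 him]
        linear_combination z ^ (1 / 2 : ℂ) * stieltjes f z * Complex.I_sq
  · intro z _
    have hsum : (‖stieltjes f z‖ + ‖stieltjes f (-z)‖) * |z.im| ≤ 2 * C * (‖z‖ + 1) := by
      have h1 := hC z
      have h2 := hC (-z)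
      rw [Complex.neg_im, abs_neg, norm_neg] at h2
      linarith
    have hle : ‖if 0 < z.im then stieltjes f z + Complex.I * stieltjes f (-z)
        else Complex.I * stieltjes f (-z) - stieltjes f z‖ ≤
        ‖stieltjes f z‖ + ‖stieltjes f (-z)‖ := by
      split_ifs
      · exact (norm_add_le _ _).trans (by simp)
      · exact (norm_sub_le _ _).trans (by simp [add_comm])
    calc _ ≤ √‖z‖ * (‖stieltjes f z‖ + ‖stieltjes f (-z)‖) * |z.im| := by
          rw [norm_mul, norm_cpow_half]
          gcongr
      _ ≤ √‖z‖ * (2 * C * (‖z‖ + 1)) := by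
          rw [mul_assoc]
          gcongr
      _ = _ := by ring

theorem norm_log_mul_abs_im_le {z : ℂ} (hz : z ≠ 0) :
    ‖Complex.log z‖ * |z.im| ≤ 4 * (√‖z‖ * (‖z‖ + 1)) := by
  have hr : 0 < ‖z‖ := norm_pos_iff.2 hz
  obtain ⟨s, hs⟩ : ∃ s, s = √‖z‖ := ⟨_, rfl⟩
  have hs0 : 0 < s := hs ▸ Real.sqrt_pos.2 hr
  have hzs : ‖z‖ = s ^ 2 := by rw [hs, Real.sq_sqrt hr.le]
  have h1 : ‖Complex.log z‖ ≤ |Real.log ‖z‖| + Real.pi := by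
    refine (Complex.norm_le_abs_re_add_abs_im _).trans ?_
    rw [Complex.log_re, Complex.log_im]
    gcongr
    exact Complex.abs_arg_le_pi z
  have h2 : |Real.log ‖z‖| ≤ 2 * (s + s⁻¹) := by
    have h3 := Real.log_le_sub_one_of_pos hs0
    have h4 := Real.log_le_sub_one_of_pos (inv_pos.2 hs0)
    have h5 := inv_pos.2 hs0
    rw [Real.log_inv] at h4
    rw [hzs, Real.log_pow, abs_le]
    push_cast
    constructor <;> linarith
  have h3 : |z.im| ≤ s ^ 2 := hzs ▸ Complex.abs_im_le_norm z
  rw [← hs, hzs]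
  calc ‖Complex.log z‖ * |z.im| ≤ (2 * (s + s⁻¹) + 4) * s ^ 2 := by
        gcongr
        linarith [Real.pi_le_four]
    _ = 2 * s ^ 3 + 2 * s + 4 * s ^ 2 := by field_simp
    _ ≤ _ := by nlinarith [mul_nonneg hs0.le (sq_nonneg (s - 1))]

open Filter Topology in
theorem exists_eq_of_stieltjes_fixed {f : ℝ → ℂ} (hf : MemE f)
    (hfix : ∀ x : ℝ, 0 < x → f x = stieltjes f x) :
    ∃ A B : ℂ, ∀ x : ℝ, 0 < x → (x : ℂ) ^ (1 / 2 : ℂ) * f x = A + B * (Real.log x : ℂ) := by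
  obtain ⟨c, hc⟩ := exists_cpow_half_mul_stieltjes_add_eq hf hfix
  obtain ⟨C, hC0, hC⟩ := norm_stieltjes_mul_abs_im_le hf
  obtain ⟨B, hB⟩ : ∃ B : ℂ, B * Real.pi * Complex.I = c :=
    ⟨c / (Real.pi * Complex.I), by
      have : (Real.pi : ℂ) ≠ 0 := by exact_mod_cast Real.pi_ne_zero
      have := Complex.I_ne_zero
      field_simp⟩
  have hdiff : ∀ z ∈ Complex.slitPlane, DifferentiableAt ℂ
      (fun z => z ^ (1 / 2 : ℂ) * stieltjes f z - B * Complex.log z) z := fun z hz =>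
    ((differentiableAt_cpow_half hz).mul (differentiableAt_stieltjes hf hz)).sub
      ((Complex.differentiableAt_log hz).const_mul B)
  suffices hconst : ∃ A, ∀ z : ℂ, z.im ≠ 0 →
      z ^ (1 / 2 : ℂ) * stieltjes f z - B * Complex.log z = A by
    obtain ⟨A, hA⟩ := hconst
    refine ⟨A, B, fun x hx => ?_⟩
    have hx' : (x : ℂ) ∈ Complex.slitPlane := Or.inl (by simpa using hx)
    have := neBot_nhdsWithin_im_ne_zero x
    have hev : ∀ᶠ z in 𝓝[{w : ℂ | w.im ≠ 0}] (x : ℂ),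
        z ^ (1 / 2 : ℂ) * stieltjes f z - B * Complex.log z = A :=
      eventually_nhdsWithin_of_forall hA
    have h1 := (hdiff x hx').continuousAt.tendsto.mono_left
      (nhdsWithin_le_nhds (s := {w : ℂ | w.im ≠ 0}))
    have h2 := tendsto_nhds_unique (h1.congr' hev) tendsto_const_nhds
    rw [Complex.ofReal_log hx.le, hfix x hx]
    linear_combination h2
  refine eq_const_of_even_of_norm_mul_abs_im_le (C := C + ‖B‖ * 4) ?_
    (fun z hz => hdiff z (Or.inr hz.ne')) ?_ ?_
  · intro z hz
    rw [cpow_half_neg_of_im_pos hz, Complex.log_neg_of_im_pos hz]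
    linear_combination -hc z hz + hB
  · intro x hx
    refine ⟨_, DifferentiableOn.analyticAt
      (fun z hz => (hdiff z hz).differentiableWithinAt)
      (Complex.isOpen_slitPlane.mem_nhds (Or.inl (by simpa using hx))),
      Eventually.of_forall fun _ _ => rfl⟩
  · intro z hz
    have hz0 : z ≠ 0 := fun h => hz (by rw [h, Complex.zero_im])
    calc _ ≤ (√‖z‖ * ‖stieltjes f z‖ + ‖B‖ * ‖Complex.log z‖) * |z.im| := by
          gcongr
          refine (norm_sub_le _ _).trans ?_
          rw [norm_mul, norm_mul, norm_cpow_half]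
      _ = √‖z‖ * (‖stieltjes f z‖ * |z.im|) + ‖B‖ * (‖Complex.log z‖ * |z.im|) := by ring
      _ ≤ √‖z‖ * (C * (‖z‖ + 1)) + ‖B‖ * (4 * (√‖z‖ * (‖z‖ + 1))) := by
          exact add_le_add (mul_le_mul_of_nonneg_left (hC z) (Real.sqrt_nonneg _))
            (mul_le_mul_of_nonneg_left (norm_log_mul_abs_im_le hz0) (norm_nonneg _))
      _ = _ := by ring

theorem integrableOn_and_integral_inv_sqrt_div_add {x : ℝ} (hx : 0 < x) :
    IntegrableOn (fun y : ℝ => (√y)⁻¹ / (x + y)) (Ioi 0) ∧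
      ∫ y in Ioi (0 : ℝ), (√y)⁻¹ / (x + y) = Real.pi * (√x)⁻¹ := by
  have hsx : 0 < √x := Real.sqrt_pos.2 hx
  have hcont : ContinuousWithinAt (fun y => 2 / √x * Real.arctan (√y / √x)) (Ici 0) 0 := by
    fun_prop
  have hderiv : ∀ y ∈ Ioi (0 : ℝ),
      HasDerivAt (fun y => 2 / √x * Real.arctan (√y / √x)) ((√y)⁻¹ / (x + y)) y := by
    intro y hy
    have hsy : 0 < √y := Real.sqrt_pos.2 hy
    have hy0 : 0 < y := hy
    refine ((((Real.hasDerivAt_sqrt hy0.ne').div_const (√x)).arctan).const_mul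
      (2 / √x)).congr_deriv ?_
    rw [div_pow, Real.sq_sqrt hx.le, Real.sq_sqrt hy0.le]
    have := Real.sq_sqrt hx.le
    field_simp
    rw [this]
  have hpos : ∀ y ∈ Ioi (0 : ℝ), 0 ≤ (√y)⁻¹ / (x + y) := by
    intro y hy
    have : 0 < y := hy
    positivity
  have hlim : Filter.Tendsto (fun y => 2 / √x * Real.arctan (√y / √x)) Filter.atTop
      (nhds (2 / √x * (Real.pi / 2))) :=
    ((Real.tendsto_arctan_atTop.mono_right nhdsWithin_le_nhds).comp
      (Real.tendsto_sqrt_atTop.atTop_div_const hsx)).const_mul _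
  refine ⟨integrableOn_Ioi_deriv_of_nonneg hcont hderiv hpos hlim, ?_⟩
  rw [integral_Ioi_of_hasDerivAt_of_nonneg hcont hderiv hpos hlim]
  simp
  ring

theorem integral_inv_sqrt_mul_log_div_add {x : ℝ} (hx : 0 < x) :
    ∫ y in Ioi (0 : ℝ), (√y)⁻¹ * Real.log (y / x) / (x + y) = 0 := by
  obtain ⟨g, hg⟩ : ∃ g : ℝ → ℝ, g = fun y => (√y)⁻¹ * Real.log (y / x) / (x + y) := ⟨_, rfl⟩
  have h1 : ∫ y in Ioi (0 : ℝ), g y = ∫ y in Ioi (0 : ℝ), -g y := by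
    have hx2 : (0 : ℝ) < x ^ 2 := by positivity
    conv_lhs => rw [← mul_zero (x ^ 2), ← integral_comp_mul_left_Ioi' g 0 hx2,
      ← integral_comp_rpow_Ioi _ (neg_ne_zero.2 one_ne_zero), ← integral_smul]
    refine setIntegral_congr_fun measurableSet_Ioi fun u hu => ?_
    have hu0 : 0 < u := hu
    have hsu : 0 < √u := Real.sqrt_pos.2 hu0
    have hlog : Real.log (x ^ 2 * u⁻¹ / x) = -Real.log (u / x) := by
      rw [← Real.log_inv]
      congr 1
      field_simp
    have hpow : u ^ (-1 - 1 : ℝ) = (u ^ 2)⁻¹ := by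
      rw [show (-1 - 1 : ℝ) = -(2 : ℕ) by norm_num, Real.rpow_neg hu0.le, Real.rpow_natCast]
    have hsqrt : √(x ^ 2 * u⁻¹) = x * (√u)⁻¹ := by
      rw [Real.sqrt_mul (by positivity), Real.sqrt_sq hx.le, Real.sqrt_inv]
    have hsq := Real.sq_sqrt hu0.le
    simp only [hg, smul_eq_mul, abs_neg, abs_one, one_mul, hpow, Real.rpow_neg_one, hlog, hsqrt]
    have : 0 < x + u := by positivity
    have : x + x ^ 2 * u⁻¹ = x * (x + u) / u := by field_simp; ring
    rw [this]
    field_simp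
    rw [hsq]
  rw [integral_neg] at h1
  rw [hg] at h1
  linarith

theorem ofReal_cpow_neg_half {x : ℝ} (hx : 0 < x) :
    (x : ℂ) ^ (-(1 / 2) : ℂ) = ((√x)⁻¹ : ℝ) := by
  rw [Real.sqrt_eq_rpow, ← Real.rpow_neg hx.le, Complex.ofReal_cpow hx.le]
  norm_num

theorem setIntegral_div_add_of_eq_cpow_mul {f : ℝ → ℂ} {A B : ℂ}
    (hf : ∀ x : ℝ, 0 < x → f x = (x : ℂ) ^ (-(1 / 2) : ℂ) * (A + B * (Real.log x : ℂ)))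
    {x : ℝ} (hx : 0 < x) (hint : IntegrableOn (fun y : ℝ => f y / ((x : ℂ) + (y : ℂ))) (Ioi 0)) :
    ∫ y in Ioi (0 : ℝ), f y / ((x : ℂ) + (y : ℂ)) = Real.pi * f x := by
  obtain ⟨h1, h2⟩ := integrableOn_and_integral_inv_sqrt_div_add hx
  have hdecomp : ∫ y in Ioi (0 : ℝ), (f y / ((x : ℂ) + (y : ℂ)) -
      (A + B * (Real.log x : ℂ)) * (((√y)⁻¹ / (x + y) : ℝ) : ℂ)) =
      ∫ y in Ioi (0 : ℝ), B * (((√y)⁻¹ * Real.log (y / x) / (x + y) : ℝ) : ℂ) := by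
    refine setIntegral_congr_fun measurableSet_Ioi fun y hy => ?_
    have hy0 : 0 < y := hy
    simp only [hf y hy0, ofReal_cpow_neg_half hy0, Real.log_div hy0.ne' hx.ne']
    push_cast
    ring
  have h3 : IntegrableOn (fun y : ℝ => (((√y)⁻¹ / (x + y) : ℝ) : ℂ)) (Ioi 0) := h1.ofReal
  rw [integral_sub hint (h3.const_mul _), integral_const_mul, integral_const_mul,
    integral_complex_ofReal, integral_complex_ofReal, h2, integral_inv_sqrt_mul_log_div_add hx] at hdecomp
  rw [hf x hx, ofReal_cpow_neg_half hx]
  push_cast at hdecomp ⊢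
  linear_combination hdecomp

/-- for `λ = 1/π`, a function `f ∈ E` solves the homogeneous Stieltjes
equation iff `f(x) = x^{-1/2}(A + B ln x)`. -/
theorem stmt2 (lam : ℂ) (hlam : lam = 1 / (Real.pi : ℂ)) (f : ℝ → ℂ) (hf : MemE f) :
    (∀ x : ℝ, 0 < x →
        IntegrableOn (fun y : ℝ => f y / ((x : ℂ) + (y : ℂ))) (Ioi 0) ∧
        f x = lam * ∫ y in Ioi (0 : ℝ), f y / ((x : ℂ) + (y : ℂ)))
    ↔ ∃ A B : ℂ, ∀ x : ℝ, 0 < x →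
        f x = (x : ℂ) ^ (-(1/2) : ℂ) * (A + B * (Real.log x : ℂ)) := by
  subst hlam
  constructor
  · intro h
    obtain ⟨A, B, hAB⟩ := exists_eq_of_stieltjes_fixed hf fun x hx => (h x hx).2
    refine ⟨A, B, fun x hx => ?_⟩
    have hx0 : (x : ℂ) ≠ 0 := by exact_mod_cast hx.ne'
    rw [← hAB x hx, ← mul_assoc, ← Complex.cpow_add _ _ hx0]
    simp
  · rintro ⟨A, B, hAB⟩ x hx
    obtain ⟨c, hc, hcx⟩ := exists_mul_one_add_le_norm_add (z := x) (Or.inl (by simpa using hx))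
    have hint : IntegrableOn (fun y : ℝ => f y / ((x : ℂ) + (y : ℂ))) (Ioi 0) :=
      integrableOn_div_add measurableSet_Ioi subset_rfl hf hc fun y hy => hcx y hy
    refine ⟨hint, ?_⟩
    have hpi : (Real.pi : ℂ) ≠ 0 := by exact_mod_cast Real.pi_ne_zero
    rw [setIntegral_div_add_of_eq_cpow_mul hAB hx hint]
    field_simp

end
end
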